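/- Let $\alpha \in (1/3,1/2)$ and $p \in (1,\infty]$ with $\alpha > 1/p$. For every $X \in W^\alpha_p([0,T];\mathbb{R}^d)$, there exists $\mathbf{X} \in W^\alpha_p([0,T]; G^2(\mathbb{R}^d))$ such that the first-level projection satisfies $\pi_1(\mathbf{X}_{0,t}) = X_t - X_0$ for all $t \in [0,T]$. -/

import Mathlib

open MeasureTheory Set

/-- The Carnot–Carathéodory norm of an element `(1, a, b)` of `T²(ℝ^d)`:
the infimum of the lengths of paths `γ` whose step-2 signature is `(1, a, b)`. -/
noncomputable def ccNorm (d : ℕ) (a : EuclideanSpace ℝ (Fin d))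
    (b : Matrix (Fin d) (Fin d) ℝ) : ℝ :=
  sInf {L : ℝ | ∃ γ : ℝ → EuclideanSpace ℝ (Fin d), ContDiff ℝ 1 γ ∧ γ 0 = 0 ∧
    (∫ t in (0:ℝ)..1, deriv γ t) = a ∧
    (∀ i j, (∫ t in (0:ℝ)..1, γ t i * deriv γ t j) = b i j) ∧
    L = ∫ t in (0:ℝ)..1, ‖deriv γ t‖}

/-- The Carnot–Carathéodory distance `d_cc(𝐗_s, 𝐗_t) = ‖𝐗_s⁻¹ ⊗ 𝐗_t‖_cc` between two
elements `(1, a₁, b₁)` and `(1, a₂, b₂)` of `G²(ℝ^d) ⊂ T²(ℝ^d)`. -/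
noncomputable def ccDist (d : ℕ) (a₁ : EuclideanSpace ℝ (Fin d))
    (b₁ : Matrix (Fin d) (Fin d) ℝ) (a₂ : EuclideanSpace ℝ (Fin d))
    (b₂ : Matrix (Fin d) (Fin d) ℝ) : ℝ :=
  ccNorm d (a₂ - a₁) (Matrix.of fun i j => b₂ i j - b₁ i j - a₁ i * (a₂ j - a₁ j))



/-! ### Part A: an upper bound for the Carnot-Caratheodory norm -/

lemma ccNorm_nonneg (d : ℕ) (a : EuclideanSpace ℝ (Fin d)) (b : Matrix (Fin d) (Fin d) ℝ) :
    0 ≤ ccNorm d a b := by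
  apply Real.sInf_nonneg
  rintro L ⟨γ, -, -, -, -, rfl⟩
  exact intervalIntegral.integral_nonneg (by norm_num) (fun t _ => norm_nonneg _)

lemma ccNorm_le_of_basis (d : ℕ) {ι : Type*} [Fintype ι] (φ ψ : ι → ℝ → ℝ)
    (hφ : ∀ m t, HasDerivAt (φ m) (ψ m t) t) (hψ : ∀ m, Continuous (ψ m))
    (h0 : ∀ m, φ m 0 = 0) (w : ι → EuclideanSpace ℝ (Fin d)) (K : ι → ℝ)
    (hK : ∀ m t, |ψ m t| ≤ K m) (a : EuclideanSpace ℝ (Fin d)) (b : Matrix (Fin d) (Fin d) ℝ)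
    (ha : ∑ m, φ m 1 • w m = a)
    (hb : ∀ i j, ∑ m, ∑ m', (∫ t in (0:ℝ)..1, φ m t * ψ m' t) * (w m i * w m' j) = b i j) :
    ccNorm d a b ≤ ∑ m, K m * ‖w m‖ := by
  set γ : ℝ → EuclideanSpace ℝ (Fin d) := fun t => ∑ m, φ m t • w m with hγ
  have hder : ∀ t, HasDerivAt γ (∑ m, ψ m t • w m) t := by
    intro t
    apply HasDerivAt.fun_sum
    intro m _
    exact (hφ m t).smul_const (w m)
  have hdc : Continuous (fun t => ∑ m, ψ m t • w m) := by
    apply continuous_finsetSum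
    intro m _
    exact (hψ m).smul continuous_const
  have hderiv : deriv γ = fun t => ∑ m, ψ m t • w m := by
    ext1 t
    exact (hder t).deriv
  have hφc : ∀ m, Continuous (φ m) := fun m =>
    continuous_iff_continuousAt.2 (fun t => (hφ m t).continuousAt)
  have hC1 : ContDiff ℝ 1 γ := by
    rw [contDiff_one_iff_deriv]
    exact ⟨fun t => (hder t).differentiableAt, by rw [hderiv]; exact hdc⟩
  have hγ0 : γ 0 = 0 := by simp [hγ, h0]
  have hLle : (∫ t in (0:ℝ)..1, ‖deriv γ t‖) ≤ ∑ m, K m * ‖w m‖ := by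
    have : ∀ t, ‖deriv γ t‖ ≤ ∑ m, K m * ‖w m‖ := by
      intro t
      rw [hderiv]
      refine (norm_sum_le _ _).trans (Finset.sum_le_sum fun m _ => ?_)
      rw [norm_smul]
      exact mul_le_mul_of_nonneg_right (hK m t) (norm_nonneg _)
    calc (∫ t in (0:ℝ)..1, ‖deriv γ t‖) ≤ ∫ t in (0:ℝ)..1, ∑ m, K m * ‖w m‖ := by
          apply intervalIntegral.integral_mono_on (by norm_num)
          · rw [hderiv]; exact (hdc.norm).intervalIntegrable _ _
          · exact continuous_const.intervalIntegrable _ _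
          · intro t _; exact this t
      _ = _ := by simp
  refine le_trans (csInf_le ?_ ?_) hLle
  · refine ⟨0, ?_⟩
    rintro L ⟨γ, -, -, -, -, rfl⟩
    exact intervalIntegral.integral_nonneg (by norm_num) (fun t _ => norm_nonneg _)
  · refine ⟨γ, hC1, hγ0, ?_, ?_, rfl⟩
    · rw [intervalIntegral.integral_deriv_eq_sub (fun t _ => (hder t).differentiableAt)
        (by rw [hderiv]; exact hdc.intervalIntegrable _ _), hγ0, sub_zero]
      exact ha
    · intro i j
      rw [← hb i j, hderiv]
      have : ∀ t, γ t i * (∑ m, ψ m t • w m).ofLp j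
          = ∑ m, ∑ m', (φ m t * ψ m' t) * (w m i * w m' j) := by
        intro t
        simp only [hγ, WithLp.ofLp_sum, WithLp.ofLp_smul, Finset.sum_apply, Pi.smul_apply,
          smul_eq_mul, Finset.sum_mul_sum]
        refine Finset.sum_congr rfl fun m _ => Finset.sum_congr rfl fun m' _ => by ring
      simp only [this]
      rw [intervalIntegral.integral_finsetSum]
      · refine Finset.sum_congr rfl fun m _ => ?_
        rw [intervalIntegral.integral_finsetSum]
        · refine Finset.sum_congr rfl fun m' _ => ?_
          rw [intervalIntegral.integral_mul_const]
        · intro m' _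
          exact (((hφc m).mul (hψ m')).mul continuous_const).intervalIntegrable _ _
      · intro m _
        apply Continuous.intervalIntegrable
        exact continuous_finsetSum _ fun m' _ => ((hφc m).mul (hψ m')).mul continuous_const

lemma int_cos_zero (n : ℤ) (hn : n ≠ 0) : ∫ t in (0:ℝ)..1, Real.cos (2 * Real.pi * n * t) = 0 := by
  have hc : (2 * Real.pi * n : ℝ) ≠ 0 := by
    have : (n:ℝ) ≠ 0 := by exact_mod_cast hn
    positivity
  rw [intervalIntegral.integral_comp_mul_left (fun x => Real.cos x) hc]
  have : Real.sin (2 * Real.pi * n) = 0 := by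
    rw [show 2 * Real.pi * n = ((2 * n : ℤ) : ℝ) * Real.pi by push_cast; ring]
    exact Real.sin_int_mul_pi _
  simp [this]

lemma int_sin_zero (n : ℤ) : ∫ t in (0:ℝ)..1, Real.sin (2 * Real.pi * n * t) = 0 := by
  by_cases hn : n = 0
  · simp [hn]
  have hc : (2 * Real.pi * n : ℝ) ≠ 0 := by
    have : (n:ℝ) ≠ 0 := by exact_mod_cast hn
    positivity
  rw [intervalIntegral.integral_comp_mul_left (fun x => Real.sin x) hc]
  have : Real.cos (2 * Real.pi * n) = 1 := by
    rw [show 2 * Real.pi * n = n * (2 * Real.pi) by ring]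
    exact Real.cos_int_mul_two_pi n
  simp [this]

lemma int_cos_cos (k l : ℕ) (hk : 0 < k) : ∫ t in (0:ℝ)..1,
    Real.cos (2 * Real.pi * k * t) * Real.cos (2 * Real.pi * l * t) = if k = l then 1 / 2 else 0 := by
  have : ∀ t : ℝ, Real.cos (2 * Real.pi * k * t) * Real.cos (2 * Real.pi * l * t)
      = (1/2) * Real.cos (2 * Real.pi * ((k - l : ℤ):ℝ) * t)
        + (1/2) * Real.cos (2 * Real.pi * ((k + l : ℤ):ℝ) * t) := by
    intro t
    push_cast
    rw [show 2 * Real.pi * ((k:ℝ) - l) * t = 2 * Real.pi * k * t - 2 * Real.pi * l * t by ring,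
      show 2 * Real.pi * ((k:ℝ) + l) * t = 2 * Real.pi * k * t + 2 * Real.pi * l * t by ring,
      Real.cos_add, Real.cos_sub]
    ring
  simp only [this]
  rw [intervalIntegral.integral_add (by apply Continuous.intervalIntegrable; fun_prop)
    (by apply Continuous.intervalIntegrable; fun_prop),
    intervalIntegral.integral_const_mul, intervalIntegral.integral_const_mul,
    int_cos_zero (k + l) (by omega)]
  split_ifs with h
  · subst h; simp
  · rw [int_cos_zero _ (by omega)]; simp

lemma int_sin_sin (k l : ℕ) (hk : 0 < k) : ∫ t in (0:ℝ)..1,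
    Real.sin (2 * Real.pi * k * t) * Real.sin (2 * Real.pi * l * t) = if k = l then 1 / 2 else 0 := by
  have : ∀ t : ℝ, Real.sin (2 * Real.pi * k * t) * Real.sin (2 * Real.pi * l * t)
      = (1/2) * Real.cos (2 * Real.pi * ((k - l : ℤ):ℝ) * t)
        - (1/2) * Real.cos (2 * Real.pi * ((k + l : ℤ):ℝ) * t) := by
    intro t
    push_cast
    rw [show 2 * Real.pi * ((k:ℝ) - l) * t = 2 * Real.pi * k * t - 2 * Real.pi * l * t by ring,
      show 2 * Real.pi * ((k:ℝ) + l) * t = 2 * Real.pi * k * t + 2 * Real.pi * l * t by ring,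
      Real.cos_add, Real.cos_sub]
    ring
  simp only [this]
  rw [intervalIntegral.integral_sub (by apply Continuous.intervalIntegrable; fun_prop)
    (by apply Continuous.intervalIntegrable; fun_prop),
    intervalIntegral.integral_const_mul, intervalIntegral.integral_const_mul,
    int_cos_zero (k + l) (by omega)]
  split_ifs with h
  · subst h; simp
  · rw [int_cos_zero _ (by omega)]; simp

lemma int_sin_cos (k l : ℕ) : ∫ t in (0:ℝ)..1,
    Real.sin (2 * Real.pi * k * t) * Real.cos (2 * Real.pi * l * t) = 0 := by
  have : ∀ t : ℝ, Real.sin (2 * Real.pi * k * t) * Real.cos (2 * Real.pi * l * t)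
      = (1/2) * Real.sin (2 * Real.pi * ((k - l : ℤ):ℝ) * t)
        + (1/2) * Real.sin (2 * Real.pi * ((k + l : ℤ):ℝ) * t) := by
    intro t
    push_cast
    rw [show 2 * Real.pi * ((k:ℝ) - l) * t = 2 * Real.pi * k * t - 2 * Real.pi * l * t by ring,
      show 2 * Real.pi * ((k:ℝ) + l) * t = 2 * Real.pi * k * t + 2 * Real.pi * l * t by ring,
      Real.sin_add, Real.sin_sub]
    ring
  simp only [this]
  rw [intervalIntegral.integral_add (by apply Continuous.intervalIntegrable; fun_prop)
    (by apply Continuous.intervalIntegrable; fun_prop),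
    intervalIntegral.integral_const_mul, intervalIntegral.integral_const_mul,
    int_sin_zero, int_sin_zero]
  simp

lemma int_t_cos (k : ℕ) (hk : 0 < k) : ∫ t in (0:ℝ)..1,
    t * Real.cos (2 * Real.pi * k * t) = 0 := by
  have hc : (2 * Real.pi * k : ℝ) ≠ 0 := by positivity
  have hs : Real.sin (2 * Real.pi * k) = 0 := by
    rw [show 2 * Real.pi * k = ((2 * k : ℤ) : ℝ) * Real.pi by push_cast; ring]
    exact Real.sin_int_mul_pi _
  have hcs : Real.cos (2 * Real.pi * k) = 1 := by
    rw [show 2 * Real.pi * k = k * (2 * Real.pi) by ring]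
    exact Real.cos_nat_mul_two_pi k
  have h := intervalIntegral.integral_eq_sub_of_hasDerivAt (a := 0) (b := 1)
    (f := fun t => t * Real.sin (2 * Real.pi * k * t) / (2 * Real.pi * k)
      + Real.cos (2 * Real.pi * k * t) / (2 * Real.pi * k) ^ 2)
    (f' := fun t => t * Real.cos (2 * Real.pi * k * t)) ?_ ?_
  · rw [h]; simp [hs, hcs]
  · intro t _
    have h1 : HasDerivAt (fun t : ℝ => 2 * Real.pi * k * t) (2 * Real.pi * k) t := by
      simpa using (hasDerivAt_id t).const_mul (2 * Real.pi * k)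
    have h2 := (((hasDerivAt_id t).mul h1.sin).div_const (2 * Real.pi * k)).add
      (h1.cos.div_const ((2 * Real.pi * k) ^ 2))
    refine h2.congr_deriv ?_
    simp only [id]
    field_simp
    ring
  · apply Continuous.intervalIntegrable; fun_prop

lemma int_t_sin (k : ℕ) (hk : 0 < k) : ∫ t in (0:ℝ)..1,
    t * Real.sin (2 * Real.pi * k * t) = - 1 / (2 * Real.pi * k) := by
  have hc : (2 * Real.pi * k : ℝ) ≠ 0 := by positivity
  have hs : Real.sin (2 * Real.pi * k) = 0 := by
    rw [show 2 * Real.pi * k = ((2 * k : ℤ) : ℝ) * Real.pi by push_cast; ring]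
    exact Real.sin_int_mul_pi _
  have hcs : Real.cos (2 * Real.pi * k) = 1 := by
    rw [show 2 * Real.pi * k = k * (2 * Real.pi) by ring]
    exact Real.cos_nat_mul_two_pi k
  have h := intervalIntegral.integral_eq_sub_of_hasDerivAt (a := 0) (b := 1)
    (f := fun t => - (t * Real.cos (2 * Real.pi * k * t) / (2 * Real.pi * k))
      + Real.sin (2 * Real.pi * k * t) / (2 * Real.pi * k) ^ 2)
    (f' := fun t => t * Real.sin (2 * Real.pi * k * t)) ?_ ?_
  · rw [h]; simp [hs, hcs]; field_simp
  · intro t _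
    have h1 : HasDerivAt (fun t : ℝ => 2 * Real.pi * k * t) (2 * Real.pi * k) t := by
      simpa using (hasDerivAt_id t).const_mul (2 * Real.pi * k)
    have h2 := (((hasDerivAt_id t).mul h1.cos).div_const (2 * Real.pi * k)).neg.add
      (h1.sin.div_const ((2 * Real.pi * k) ^ 2))
    refine h2.congr_deriv ?_
    simp only [id]
    field_simp
    ring
  · apply Continuous.intervalIntegrable; fun_prop


/-- the loop function `sin`. -/
noncomputable def uF (k : ℕ) (t : ℝ) : ℝ := Real.sin (2 * Real.pi * k * t)
/-- the loop function `cos - cos`. -/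
noncomputable def vF (k : ℕ) (t : ℝ) : ℝ :=
  Real.cos (2 * Real.pi * k * t) - Real.cos (2 * Real.pi * (1:ℕ) * t)
/-- derivative of `uF`. -/
noncomputable def uF' (k : ℕ) (t : ℝ) : ℝ := 2 * Real.pi * k * Real.cos (2 * Real.pi * k * t)
/-- derivative of `vF`. -/
noncomputable def vF' (k : ℕ) (t : ℝ) : ℝ :=
  - (2 * Real.pi * k) * Real.sin (2 * Real.pi * k * t)
    + 2 * Real.pi * Real.sin (2 * Real.pi * (1:ℕ) * t)

lemma hasDerivAt_uF (k : ℕ) (t : ℝ) : HasDerivAt (uF k) (uF' k t) t := by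
  have h1 : HasDerivAt (fun t : ℝ => 2 * Real.pi * k * t) (2 * Real.pi * k) t := by
    simpa using (hasDerivAt_id t).const_mul (2 * Real.pi * k)
  refine h1.sin.congr_deriv ?_
  simp only [uF']; ring

lemma hasDerivAt_vF (k : ℕ) (t : ℝ) : HasDerivAt (vF k) (vF' k t) t := by
  have h1 : ∀ k : ℕ, HasDerivAt (fun t : ℝ => 2 * Real.pi * k * t) (2 * Real.pi * k) t := by
    intro k
    simpa using (hasDerivAt_id t).const_mul (2 * Real.pi * k)
  refine (((h1 k).cos).sub (h1 1).cos).congr_deriv ?_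
  simp only [vF']; push_cast; ring

lemma continuous_uF' (k : ℕ) : Continuous (uF' k) := by unfold uF'; fun_prop
lemma continuous_vF' (k : ℕ) : Continuous (vF' k) := by unfold vF'; fun_prop

lemma gram_tu (k : ℕ) (hk : 2 ≤ k) : ∫ t in (0:ℝ)..1, t * uF' k t = 0 := by
  have : ∀ t : ℝ, t * uF' k t = (2 * Real.pi * k) * (t * Real.cos (2 * Real.pi * k * t)) := by
    intro t; unfold uF'; ring
  simp only [this]
  rw [intervalIntegral.integral_const_mul, int_t_cos k (by omega), mul_zero]

lemma gram_tv (k : ℕ) (hk : 2 ≤ k) : ∫ t in (0:ℝ)..1, t * vF' k t = 0 := by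
  have : ∀ t : ℝ, t * vF' k t = -(2 * Real.pi * k) * (t * Real.sin (2 * Real.pi * k * t))
    + (2 * Real.pi) * (t * Real.sin (2 * Real.pi * (1:ℕ) * t)) := by
    intro t; unfold vF'; ring
  simp only [this]
  rw [intervalIntegral.integral_add (by apply Continuous.intervalIntegrable; fun_prop)
    (by apply Continuous.intervalIntegrable; fun_prop), intervalIntegral.integral_const_mul,
    intervalIntegral.integral_const_mul, int_t_sin k (by omega), int_t_sin 1 (by omega)]
  have : (k:ℝ) ≠ 0 := by have : k ≠ 0 := by omega
                         exact_mod_cast this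
  have := Real.pi_ne_zero
  field_simp
  push_cast; ring

lemma gram_ut (k : ℕ) : ∫ t in (0:ℝ)..1, uF k t * 1 = 0 := by
  simpa [uF] using int_sin_zero k

lemma gram_vt (k : ℕ) (hk : 2 ≤ k) : ∫ t in (0:ℝ)..1, vF k t * 1 = 0 := by
  have h1 := int_cos_zero k (by omega)
  have h2 := int_cos_zero (1:ℕ) (by norm_num)
  simp only [vF, mul_one]
  rw [intervalIntegral.integral_sub (by apply Continuous.intervalIntegrable; fun_prop)
    (by apply Continuous.intervalIntegrable; fun_prop)]
  simp only [Int.cast_natCast] at h1 h2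
  rw [h1, h2, sub_zero]

lemma gram_uu (k l : ℕ) : ∫ t in (0:ℝ)..1, uF k t * uF' l t = 0 := by
  have : ∀ t : ℝ, uF k t * uF' l t
      = (2 * Real.pi * l) * (Real.sin (2 * Real.pi * k * t) * Real.cos (2 * Real.pi * l * t)) := by
    intro t; unfold uF uF'; ring
  simp only [this]
  rw [intervalIntegral.integral_const_mul, int_sin_cos, mul_zero]

lemma gram_uv (k l : ℕ) (hk : 2 ≤ k) :
    ∫ t in (0:ℝ)..1, uF k t * vF' l t = if k = l then - (Real.pi * k) else 0 := by
  have : ∀ t : ℝ, uF k t * vF' l t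
      = -(2 * Real.pi * l) * (Real.sin (2 * Real.pi * k * t) * Real.sin (2 * Real.pi * l * t))
      + (2 * Real.pi) *
        (Real.sin (2 * Real.pi * k * t) * Real.sin (2 * Real.pi * (1:ℕ) * t)) := by
    intro t; unfold uF vF'; ring
  simp only [this]
  rw [intervalIntegral.integral_add (by apply Continuous.intervalIntegrable; fun_prop)
    (by apply Continuous.intervalIntegrable; fun_prop), intervalIntegral.integral_const_mul,
    intervalIntegral.integral_const_mul, int_sin_sin k l (by omega), int_sin_sin k 1 (by omega),
    if_neg (show k ≠ 1 by omega)]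
  split_ifs with h
  · subst h; ring
  · simp

lemma gram_vu (k l : ℕ) (hk : 2 ≤ k) (hl : 2 ≤ l) :
    ∫ t in (0:ℝ)..1, vF k t * uF' l t = if k = l then (Real.pi * k) else 0 := by
  have : ∀ t : ℝ, vF k t * uF' l t
      = (2 * Real.pi * l) * (Real.cos (2 * Real.pi * k * t) * Real.cos (2 * Real.pi * l * t))
      - (2 * Real.pi * l) *
        (Real.cos (2 * Real.pi * (1:ℕ) * t) * Real.cos (2 * Real.pi * l * t)) := by
    intro t; unfold vF uF'; ring
  simp only [this]
  rw [intervalIntegral.integral_sub (by apply Continuous.intervalIntegrable; fun_prop)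
    (by apply Continuous.intervalIntegrable; fun_prop), intervalIntegral.integral_const_mul,
    intervalIntegral.integral_const_mul, int_cos_cos k l (by omega), int_cos_cos 1 l (by omega),
    if_neg (show 1 ≠ l by omega)]
  split_ifs with h
  · subst h; ring
  · simp

lemma gram_vv (k l : ℕ) : ∫ t in (0:ℝ)..1, vF k t * vF' l t = 0 := by
  have : ∀ t : ℝ, vF k t * vF' l t
      = (-(2 * Real.pi * l) * (Real.sin (2 * Real.pi * l * t) * Real.cos (2 * Real.pi * k * t))
      + (2 * Real.pi) *
        (Real.sin (2 * Real.pi * (1:ℕ) * t) * Real.cos (2 * Real.pi * k * t)))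
      + ((2 * Real.pi * l) * (Real.sin (2 * Real.pi * l * t) * Real.cos (2 * Real.pi * (1:ℕ) * t))
      + -(2 * Real.pi) *
        (Real.sin (2 * Real.pi * (1:ℕ) * t) * Real.cos (2 * Real.pi * (1:ℕ) * t))) := by
    intro t; unfold vF vF'; ring
  simp only [this]
  rw [intervalIntegral.integral_add (by apply Continuous.intervalIntegrable; fun_prop)
    (by apply Continuous.intervalIntegrable; fun_prop),
    intervalIntegral.integral_add (by apply Continuous.intervalIntegrable; fun_prop)
    (by apply Continuous.intervalIntegrable; fun_prop),
    intervalIntegral.integral_add (by apply Continuous.intervalIntegrable; fun_prop)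
    (by apply Continuous.intervalIntegrable; fun_prop)]
  simp only [intervalIntegral.integral_const_mul, int_sin_cos, mul_zero, add_zero]

lemma exists_sqrt_factor (c : ℝ) : ∃ x y : ℝ, x * y = c ∧ |x| = √|c| ∧ |y| = √|c| := by
  rcases le_total 0 c with h | h
  · refine ⟨√c, √c, Real.mul_self_sqrt h, ?_, ?_⟩ <;>
    rw [abs_of_nonneg (Real.sqrt_nonneg _), abs_of_nonneg h]
  · refine ⟨√(-c), -√(-c), ?_, ?_, ?_⟩
    · have := Real.mul_self_sqrt (neg_nonneg.2 h); linarith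
    · rw [abs_of_nonneg (Real.sqrt_nonneg _), abs_of_nonpos h]
    · rw [abs_neg, abs_of_nonneg (Real.sqrt_nonneg _), abs_of_nonpos h]

theorem ccNorm_le (d : ℕ) : ∃ C : ℝ, 0 ≤ C ∧ ∀ (a : EuclideanSpace ℝ (Fin d))
    (b : Matrix (Fin d) (Fin d) ℝ), (∀ i j, b i j + b j i = a i * a j) →
    ccNorm d a b ≤ ‖a‖ + C * ∑ m : Fin d × Fin d, √|b m.1 m.2 - a m.1 * a m.2 / 2| := by
  set N := Fintype.card (Fin d × Fin d) with hN
  set k : Fin d × Fin d → ℕ := fun m => (Fintype.equivFin (Fin d × Fin d) m : ℕ) + 2 with hk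
  have hk2 : ∀ m, 2 ≤ k m := fun m => by simp [hk]
  have hkN : ∀ m, (k m : ℝ) ≤ N + 2 := fun m => by
    have := (Fintype.equivFin (Fin d × Fin d) m).2
    have h2 : k m ≤ N + 2 := by simp only [hk]; omega
    exact_mod_cast h2
  have hkinj : ∀ m m', k m = k m' ↔ m = m' := by
    intro m m'
    simp only [hk, Nat.add_right_cancel_iff, Fin.val_inj, EmbeddingLike.apply_eq_iff_eq]
  have hpi := Real.pi_pos
  refine ⟨4 * Real.pi * (N + 2) + 2 * Real.pi, by positivity, ?_⟩
  intro a b hab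
  set A : Fin d × Fin d → ℝ := fun m => b m.1 m.2 - a m.1 * a m.2 / 2 with hA
  have hAanti : ∀ i j, A (j, i) = - A (i, j) := by
    intro i j
    have := hab i j
    simp only [hA]; nlinarith
  choose x y hxy hx hy using fun m => exists_sqrt_factor (A m / (2 * Real.pi * k m))
  have hsq : ∀ m, √|A m / (2 * Real.pi * k m)| ≤ √|A m| := by
    intro m
    apply Real.sqrt_le_sqrt
    rw [abs_div]
    apply div_le_self (abs_nonneg _)
    have h1 : (2:ℝ) ≤ k m := by exact_mod_cast hk2 m
    have := Real.pi_gt_three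
    rw [abs_of_nonneg (by positivity)]
    nlinarith
  set φ : Unit ⊕ ((Fin d × Fin d) ⊕ (Fin d × Fin d)) → ℝ → ℝ :=
    Sum.elim (fun _ t => t) (Sum.elim (fun m => uF (k m)) (fun m => vF (k m))) with hφ
  set ψ : Unit ⊕ ((Fin d × Fin d) ⊕ (Fin d × Fin d)) → ℝ → ℝ :=
    Sum.elim (fun _ _ => 1) (Sum.elim (fun m => uF' (k m)) (fun m => vF' (k m))) with hψ
  set w : Unit ⊕ ((Fin d × Fin d) ⊕ (Fin d × Fin d)) → EuclideanSpace ℝ (Fin d) :=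
    Sum.elim (fun _ => a) (Sum.elim (fun m => EuclideanSpace.single m.2 (x m))
      (fun m => EuclideanSpace.single m.1 (y m))) with hw
  set K : Unit ⊕ ((Fin d × Fin d) ⊕ (Fin d × Fin d)) → ℝ :=
    Sum.elim (fun _ => 1) (Sum.elim (fun m => 2 * Real.pi * (N + 2))
      (fun m => 2 * Real.pi * (N + 2) + 2 * Real.pi)) with hKd
  refine (ccNorm_le_of_basis d φ ψ ?_ ?_ ?_ w K ?_ a b ?_ ?_).trans ?_
  · rintro (_ | m | m) t
    · exact hasDerivAt_id t
    · exact hasDerivAt_uF _ t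
    · exact hasDerivAt_vF _ t
  · rintro (_ | m | m)
    · exact continuous_const
    · exact continuous_uF' _
    · exact continuous_vF' _
  · rintro (_ | m | m)
    · rfl
    · simp [hφ, uF]
    · simp [hφ, vF]
  · rintro (_ | m | m) t
    · simp [hψ, hKd]
    · simp only [hψ, hKd, Sum.elim_inr, Sum.elim_inl, uF']
      have h1 := Real.abs_cos_le_one (2 * Real.pi * k m * t)
      rw [abs_mul, abs_of_nonneg (by positivity)]
      have := hkN m
      calc 2 * Real.pi * k m * _ ≤ 2 * Real.pi * k m * 1 := by gcongr
        _ ≤ _ := by rw [mul_one]; gcongr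
    · simp only [hψ, hKd, Sum.elim_inr, vF']
      refine (abs_add_le _ _).trans ?_
      have h1 := Real.abs_sin_le_one (2 * Real.pi * k m * t)
      have h2 := Real.abs_sin_le_one (2 * Real.pi * (1:ℕ) * t)
      rw [abs_mul, abs_mul, abs_neg, abs_of_nonneg (show 0 ≤ 2 * Real.pi * k m by positivity),
        abs_of_nonneg (show 0 ≤ 2 * Real.pi by positivity)]
      have := hkN m
      apply add_le_add
      · calc 2 * Real.pi * k m * _ ≤ 2 * Real.pi * k m * 1 := by gcongr
          _ ≤ _ := by rw [mul_one]; gcongr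
      · calc 2 * Real.pi * _ ≤ 2 * Real.pi * 1 := by gcongr
          _ ≤ _ := by rw [mul_one]
  · have hu1 : ∀ m, uF (k m) 1 = 0 := by
      intro m
      rw [uF, show 2 * Real.pi * k m * 1 = ((2 * k m : ℤ) : ℝ) * Real.pi by push_cast; ring]
      exact Real.sin_int_mul_pi _
    have hv1 : ∀ m, vF (k m) 1 = 0 := by
      intro m
      rw [vF, show 2 * Real.pi * k m * 1 = k m * (2 * Real.pi) by ring,
        show 2 * Real.pi * (1:ℕ) * 1 = (1:ℕ) * (2 * Real.pi) by ring,
        Real.cos_nat_mul_two_pi, Real.cos_nat_mul_two_pi, sub_self]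
    simp [Fintype.sum_sum_type, hφ, hw, hu1, hv1]
  · intro i j
    have htt : ∫ t in (0:ℝ)..1, t * 1 = 1 / 2 := by simp
    simp only [Fintype.sum_sum_type, hφ, hψ, hw, Sum.elim_inl, Sum.elim_inr, htt,
      gram_tu _ (hk2 _), gram_tv _ (hk2 _), gram_ut, gram_vt _ (hk2 _), gram_uu,
      gram_uv _ _ (hk2 _), gram_vu _ _ (hk2 _) (hk2 _), gram_vv, hkinj]
    simp only [Finset.univ_unique, Finset.sum_const, zero_mul,
      ite_mul, Finset.sum_ite_eq, Finset.mem_univ, if_true, add_zero, zero_add, smul_zero]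
    simp only [PiLp.single_apply, Finset.card_singleton, one_smul]
    have e1 : ∀ m : Fin d × Fin d, -(Real.pi * (k m:ℝ)) * ((if i = m.2 then x m else 0) *
        (if j = m.1 then y m else 0)) = if m = (j, i) then -(A m / 2) else 0 := by
      intro m
      have h0 : (k m : ℝ) ≠ 0 := by have := hk2 m; positivity
      have h1 : Real.pi * (k m:ℝ) * (x m * y m) = A m / 2 := by
        rw [hxy]; field_simp
      by_cases h : m = (j, i)
      · subst h; simp only [if_true]; linarith
      · rw [if_neg h]
        by_cases h2 : i = m.2
        · have : j ≠ m.1 := by rintro rfl; exact h (by rw [h2])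
          simp [this]
        · simp [h2]
    have e2 : ∀ m : Fin d × Fin d, (Real.pi * (k m:ℝ)) * ((if i = m.1 then y m else 0) *
        (if j = m.2 then x m else 0)) = if m = (i, j) then (A m / 2) else 0 := by
      intro m
      have h0 : (k m : ℝ) ≠ 0 := by have := hk2 m; positivity
      have h1 : Real.pi * (k m:ℝ) * (x m * y m) = A m / 2 := by
        rw [hxy]; field_simp
      by_cases h : m = (i, j)
      · subst h; simp only [if_true]; linarith
      · rw [if_neg h]
        by_cases h2 : j = m.2
        · have : i ≠ m.1 := by rintro rfl; exact h (by rw [h2])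
          simp [this]
        · simp [h2]
    simp only [e1, e2, Finset.sum_ite_eq', Finset.mem_univ, if_true]
    rw [hAanti i j]
    simp only [hA]
    ring
  · simp only [Fintype.sum_sum_type, hKd, hw, Sum.elim_inl, Sum.elim_inr, Finset.univ_unique,
      Finset.sum_singleton, one_mul, PiLp.norm_single, Real.norm_eq_abs, hx, hy]
    gcongr
    rw [Finset.mul_sum, ← Finset.sum_add_distrib]
    refine Finset.sum_le_sum fun m _ => ?_
    have := hsq m
    have hp : 0 ≤ 4 * Real.pi * (N + 2) + 2 * Real.pi := by positivity
    calc _ = (4 * Real.pi * (N + 2) + 2 * Real.pi) * √|A m / (2 * Real.pi * k m)| := by ring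
      _ ≤ _ := by gcongr


/-! ### Part B: the mollification kernel -/

/-- dyadic scale -/
noncomputable def eS (T : ℝ) (n : ℕ) : ℝ := T / 2 ^ n

/-- tent function on `[0,T]` with integral one -/
noncomputable def tent (T y : ℝ) : ℝ := 4 / T ^ 2 * max 0 (T / 2 - |y - T / 2|)

/-- mollification kernel, staying inside `[0,T]` -/
noncomputable def kS (T : ℝ) (n : ℕ) (t z : ℝ) : ℝ := 2 ^ n * tent T (2 ^ n * z - (2 ^ n - 1) * t)

lemma eS_pos {T : ℝ} (hT : 0 < T) (n : ℕ) : 0 < eS T n := by unfold eS; positivity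

lemma eS_succ (T : ℝ) (n : ℕ) : eS T (n + 1) = eS T n / 2 := by
  unfold eS; rw [pow_succ]; field_simp

lemma tent_nonneg (T y : ℝ) : 0 ≤ tent T y := by unfold tent; positivity

lemma tent_le {T : ℝ} (hT : 0 < T) (y : ℝ) : tent T y ≤ 2 / T := by
  unfold tent
  have h : max 0 (T / 2 - |y - T / 2|) ≤ T / 2 :=
    max_le (by positivity) (by linarith [abs_nonneg (y - T / 2)])
  calc _ ≤ 4 / T ^ 2 * (T / 2) := by gcongr
    _ = _ := by field_simp; norm_num

lemma tent_zero_left {T y : ℝ} (hy : y ≤ 0) : tent T y = 0 := by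
  unfold tent
  have := neg_abs_le (y - T / 2)
  rw [max_eq_left (by linarith), mul_zero]

lemma tent_zero_right {T y : ℝ} (hy : T ≤ y) : tent T y = 0 := by
  unfold tent
  have := le_abs_self (y - T / 2)
  rw [max_eq_left (by linarith), mul_zero]

lemma tent_lip {T : ℝ} (hT : 0 < T) (x y : ℝ) : |tent T x - tent T y| ≤ 4 / T ^ 2 * |x - y| := by
  unfold tent
  rw [← mul_sub, abs_mul, abs_of_nonneg (show 0 ≤ 4 / T ^ 2 by positivity)]
  refine mul_le_mul_of_nonneg_left ?_ (by positivity)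
  refine (abs_max_sub_max_le_max (0:ℝ) (T / 2 - |x - T / 2|) 0 (T / 2 - |y - T / 2|)).trans ?_
  simp only [sub_self, abs_zero]
  apply max_le (abs_nonneg _)
  rw [show T / 2 - |x - T / 2| - (T / 2 - |y - T / 2|) = |y - T / 2| - |x - T / 2| by ring]
  refine (abs_abs_sub_abs_le (y - T / 2) (x - T / 2)).trans ?_
  rw [show y - T / 2 - (x - T / 2) = -(x - y) by ring, abs_neg]

lemma continuous_tent (T : ℝ) : Continuous (tent T) := by unfold tent; fun_prop

lemma integral_tent {T : ℝ} (hT : 0 < T) : ∫ y in (0:ℝ)..T, tent T y = 1 := by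
  have hc : ∀ a b, IntervalIntegrable (tent T) volume a b :=
    fun a b => (continuous_tent T).intervalIntegrable a b
  rw [← intervalIntegral.integral_add_adjacent_intervals (hc 0 (T / 2)) (hc (T / 2) T)]
  have h1 : ∫ y in (0:ℝ)..(T / 2), tent T y = ∫ y in (0:ℝ)..(T / 2), 4 / T ^ 2 * y := by
    apply intervalIntegral.integral_congr
    intro y hy
    rw [uIcc_of_le (by positivity)] at hy
    simp only [tent]
    rw [abs_of_nonpos (by linarith [hy.2]), max_eq_right (by linarith [hy.1])]
    ring
  have h2 : ∫ y in (T / 2)..T, tent T y = ∫ y in (T / 2)..T, 4 / T ^ 2 * (T - y) := by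
    apply intervalIntegral.integral_congr
    intro y hy
    rw [uIcc_of_le (by linarith)] at hy
    simp only [tent]
    rw [abs_of_nonneg (by linarith [hy.1]), max_eq_right (by linarith [hy.2])]
    ring
  rw [h1, h2, intervalIntegral.integral_const_mul, intervalIntegral.integral_const_mul,
    intervalIntegral.integral_sub (by simp) (by simp)]
  simp
  field_simp
  ring

lemma continuous_kS (T : ℝ) (n : ℕ) : Continuous (fun q : ℝ × ℝ => kS T n q.1 q.2) := by
  unfold kS
  have := continuous_tent T
  fun_prop

lemma kS_nonneg (T : ℝ) (n : ℕ) (t z : ℝ) : 0 ≤ kS T n t z :=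
  mul_nonneg (by positivity) (tent_nonneg _ _)

lemma kS_le {T : ℝ} (hT : 0 < T) (n : ℕ) (t z : ℝ) : kS T n t z ≤ 2 / eS T n := by
  unfold kS eS
  calc _ ≤ 2 ^ n * (2 / T) := by gcongr; exact tent_le hT _
    _ = _ := by field_simp

lemma kS_lip {T : ℝ} (hT : 0 < T) (n : ℕ) (t s z : ℝ) :
    |kS T n t z - kS T n s z| ≤ 4 * |t - s| / eS T n ^ 2 := by
  unfold kS eS
  rw [← mul_sub, abs_mul, abs_of_nonneg (show (0:ℝ) ≤ 2 ^ n by positivity)]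
  have h1 : (1:ℝ) ≤ 2 ^ n := one_le_pow₀ (by norm_num)
  calc _ ≤ 2 ^ n * (4 / T ^ 2 * |2 ^ n * z - (2 ^ n - 1) * t - (2 ^ n * z - (2 ^ n - 1) * s)|) := by
        gcongr; exact tent_lip hT _ _
    _ = 2 ^ n * (4 / T ^ 2 * ((2 ^ n - 1) * |t - s|)) := by
        rw [show (2:ℝ) ^ n * z - (2 ^ n - 1) * t - (2 ^ n * z - (2 ^ n - 1) * s)
          = - ((2 ^ n - 1) * (t - s)) by ring, abs_neg, abs_mul,
          abs_of_nonneg (show (0:ℝ) ≤ 2 ^ n - 1 by linarith)]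
    _ ≤ 2 ^ n * (4 / T ^ 2 * (2 ^ n * |t - s|)) := by gcongr; linarith
    _ = _ := by field_simp

lemma kS_supp {T : ℝ} (n : ℕ) {t z : ℝ} (ht : t ∈ Icc 0 T)
    (h : eS T n < |z - t|) : kS T n t z = 0 := by
  have h2 : (0:ℝ) < 2 ^ n := by positivity
  unfold eS at h
  rw [div_lt_iff₀ h2] at h
  have key : (2:ℝ) ^ n * z - (2 ^ n - 1) * t ≤ 0 ∨ T ≤ 2 ^ n * z - (2 ^ n - 1) * t := by
    rcases abs_cases (z - t) with ⟨h3, _⟩ | ⟨h3, _⟩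
    · right; rw [h3] at h; nlinarith [ht.1]
    · left; rw [h3] at h; nlinarith [ht.2]
  unfold kS
  rcases key with h | h
  · rw [tent_zero_left h, mul_zero]
  · rw [tent_zero_right h, mul_zero]

lemma kS_integral {T : ℝ} (hT : 0 < T) (n : ℕ) {t : ℝ} (ht : t ∈ Icc 0 T) :
    ∫ z in Icc 0 T, kS T n t z = 1 := by
  have h1 : (1:ℝ) ≤ 2 ^ n := one_le_pow₀ (by norm_num)
  rw [integral_Icc_eq_integral_Ioc, ← intervalIntegral.integral_of_le hT.le]
  unfold kS
  rw [intervalIntegral.integral_const_mul, intervalIntegral.integral_comp_mul_sub _ (by positivity)]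
  set c : ℝ := 2 ^ n with hc
  have hd : 0 ≤ (c - 1) * t := mul_nonneg (by linarith) ht.1
  have hd2 : T ≤ c * T - (c - 1) * t := by nlinarith [ht.2]
  have hi : ∀ a b, IntervalIntegrable (tent T) volume a b :=
    fun a b => (continuous_tent T).intervalIntegrable a b
  rw [← intervalIntegral.integral_add_adjacent_intervals (hi _ 0) (hi 0 _),
    ← intervalIntegral.integral_add_adjacent_intervals (hi 0 T) (hi T _), integral_tent hT]
  have z1 : ∫ y in (c * 0 - (c - 1) * t)..0, tent T y = 0 := by
    rw [intervalIntegral.integral_congr (g := fun _ => 0), intervalIntegral.integral_zero]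
    intro y hy
    rw [uIcc_of_le (by linarith)] at hy
    exact tent_zero_left hy.2
  have z2 : ∫ y in T..(c * T - (c - 1) * t), tent T y = 0 := by
    rw [intervalIntegral.integral_congr (g := fun _ => 0), intervalIntegral.integral_zero]
    intro y hy
    rw [uIcc_of_le (by linarith)] at hy
    exact tent_zero_right hy.1
  rw [z1, z2]
  simp

lemma kS_zero (T t z : ℝ) : kS T 0 t z = tent T z := by simp [kS]


/-! ### Part C: mollified functions and local oscillation -/

open scoped ENNReal

/-- local mean oscillation at scale `eS T n` -/
noncomputable def mE {V : Type*} [NormedAddCommGroup V] (X : ℝ → V) (T : ℝ) (n : ℕ) (t : ℝ) : ℝ≥0∞ :=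
  ENNReal.ofReal (eS T n)⁻¹ *
    ∫⁻ z in Icc 0 T, {z : ℝ | |z - t| ≤ 2 * eS T n}.indicator (fun z => ‖X z - X t‖ₑ) z

/-- mollified function -/
noncomputable def pS (T : ℝ) (g : ℝ → ℝ) (n : ℕ) (t : ℝ) : ℝ := ∫ z in Icc 0 T, kS T n t z * g z

section
variable {V : Type*} [NormedAddCommGroup V]

lemma mE_lt_top {X : ℝ → V} (hX : Continuous X) (T : ℝ) (n : ℕ) (t : ℝ) : mE X T n t < ⊤ := by
  unfold mE
  refine ENNReal.mul_lt_top ENNReal.ofReal_lt_top ?_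
  have hc : ContinuousOn (fun z => ‖X z - X t‖) (Icc 0 T) := by fun_prop
  have hi : Integrable (fun z => ‖X z - X t‖) (volume.restrict (Icc 0 T)) :=
    hc.integrableOn_compact isCompact_Icc
  have := hi.2
  unfold HasFiniteIntegral at this
  refine lt_of_le_of_lt (lintegral_mono fun z => ?_) this
  refine (indicator_le_self _ _ z).trans ?_
  simp

lemma mE_succ_le {X : ℝ → V} {T : ℝ} (hT : 0 < T) (n : ℕ) (t : ℝ) :
    mE X T (n + 1) t ≤ 2 * mE X T n t := by
  unfold mE
  have h := eS_pos hT n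
  rw [eS_succ, ← mul_assoc]
  gcongr
  · rw [show (2:ℝ≥0∞) = ENNReal.ofReal 2 by simp, ← ENNReal.ofReal_mul (by norm_num)]
    apply ENNReal.ofReal_le_ofReal
    apply le_of_eq; field_simp
  · linarith

lemma kS_integrable (T : ℝ) (n : ℕ) (t : ℝ) {g : ℝ → ℝ} (hg : Continuous g) :
    IntegrableOn (fun z => kS T n t z * g z) (Icc 0 T) := by
  apply ContinuousOn.integrableOn_compact isCompact_Icc
  apply Continuous.continuousOn
  exact ((continuous_kS T n).comp (by fun_prop : Continuous fun z : ℝ => (t, z))).mul hg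

lemma pS_sub {T : ℝ} (hT : 0 < T) {g : ℝ → ℝ} (hg : Continuous g) (n : ℕ) {t : ℝ}
    (ht : t ∈ Icc 0 T) (c : ℝ) : pS T g n t - c = ∫ z in Icc 0 T, kS T n t z * (g z - c) := by
  have : c = ∫ z in Icc 0 T, kS T n t z * c := by
    rw [integral_mul_const, kS_integral hT n ht, one_mul]
  conv_lhs => rw [this]
  unfold pS
  rw [← integral_sub (kS_integrable T n t hg) (kS_integrable T n t continuous_const)]
  congr 1; ext z; ring

lemma pS_sub_enorm {X : ℝ → V} {T : ℝ} (hT : 0 < T) {g : ℝ → ℝ}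
    (hg : Continuous g) (hgX : ∀ z w, |g z - g w| ≤ ‖X z - X w‖) (n : ℕ) {t : ℝ}
    (ht : t ∈ Icc 0 T) : ‖pS T g n t - g t‖ₑ ≤ 2 * mE X T n t := by
  rw [pS_sub hT hg n ht]
  refine (enorm_integral_le_lintegral_enorm _).trans ?_
  unfold mE
  rw [← mul_assoc, show (2:ℝ≥0∞) = ENNReal.ofReal 2 by simp, ← ENNReal.ofReal_mul (by norm_num),
    ← lintegral_const_mul' _ _ ENNReal.ofReal_ne_top]
  refine lintegral_mono fun z => ?_
  simp only [indicator_apply, mem_ofPred_eq]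
  have he := eS_pos hT n
  split_ifs with h
  · rw [enorm_mul]
    refine mul_le_mul' ?_ ?_
    · rw [Real.enorm_eq_ofReal (kS_nonneg _ _ _ _)]
      exact ENNReal.ofReal_le_ofReal ((kS_le hT n t z).trans (le_of_eq (div_eq_mul_inv _ _)))
    · rw [← ofReal_norm, ← ofReal_norm]
      exact ENNReal.ofReal_le_ofReal (hgX z t)
  · rw [kS_supp n ht (by linarith)]
    simp

lemma pS_lip_enorm {X : ℝ → V} {T : ℝ} (hT : 0 < T) {g : ℝ → ℝ}
    (hg : Continuous g) (hgX : ∀ z w, |g z - g w| ≤ ‖X z - X w‖) (n : ℕ) {t s : ℝ}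
    (ht : t ∈ Icc 0 T) (hs : s ∈ Icc 0 T) (hts : |t - s| ≤ eS T n) :
    ‖pS T g n t - pS T g n s‖ₑ ≤ ENNReal.ofReal (4 * (|t - s| / eS T n)) * mE X T n s := by
  have he := eS_pos hT n
  rw [show pS T g n t - pS T g n s = (pS T g n t - g s) - (pS T g n s - g s) by ring,
    pS_sub hT hg n ht, pS_sub hT hg n hs, ← integral_sub
      (kS_integrable T n t (by fun_prop)) (kS_integrable T n s (by fun_prop))]
  refine (enorm_integral_le_lintegral_enorm _).trans ?_
  unfold mE
  rw [← mul_assoc, ← ENNReal.ofReal_mul (by positivity),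
    ← lintegral_const_mul' _ _ ENNReal.ofReal_ne_top]
  refine lintegral_mono fun z => ?_
  simp only [indicator_apply, mem_ofPred_eq]
  rw [← sub_mul]
  split_ifs with h
  · rw [enorm_mul]
    refine mul_le_mul' ?_ ?_
    · rw [← ofReal_norm]
      refine ENNReal.ofReal_le_ofReal ((kS_lip hT n t s z).trans (le_of_eq ?_))
      field_simp
    · rw [← ofReal_norm, ← ofReal_norm]
      exact ENNReal.ofReal_le_ofReal (hgX z s)
  · have h1 : eS T n < |z - t| := by
      have := abs_sub_le z t s
      linarith
    rw [kS_supp n ht h1, kS_supp n hs (by linarith)]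
    simp

/-- real version of `mE` -/
noncomputable def mR (X : ℝ → V) (T : ℝ) (n : ℕ) (t : ℝ) : ℝ := (mE X T n t).toReal

lemma mR_nonneg (X : ℝ → V) (T : ℝ) (n : ℕ) (t : ℝ) : 0 ≤ mR X T n t := ENNReal.toReal_nonneg

lemma ofReal_mR {X : ℝ → V} (hX : Continuous X) (T : ℝ) (n : ℕ) (t : ℝ) :
    ENNReal.ofReal (mR X T n t) = mE X T n t := ENNReal.ofReal_toReal (mE_lt_top hX T n t).ne

lemma mR_succ_le {X : ℝ → V} (hX : Continuous X) {T : ℝ} (hT : 0 < T) (n : ℕ) (t : ℝ) :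
    mR X T (n + 1) t ≤ 2 * mR X T n t := by
  have := mE_succ_le (X := X) hT n t
  rw [← ofReal_mR hX, ← ofReal_mR hX, show (2:ℝ≥0∞) = ENNReal.ofReal 2 by simp,
    ← ENNReal.ofReal_mul (by norm_num)] at this
  exact (ENNReal.ofReal_le_ofReal_iff (mul_nonneg (by norm_num) (mR_nonneg _ _ _ _))).1 this

lemma pS_sub_abs {X : ℝ → V} (hX : Continuous X) {T : ℝ} (hT : 0 < T) {g : ℝ → ℝ}
    (hg : Continuous g) (hgX : ∀ z w, |g z - g w| ≤ ‖X z - X w‖) (n : ℕ) {t : ℝ}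
    (ht : t ∈ Icc 0 T) : |pS T g n t - g t| ≤ 2 * mR X T n t := by
  have := pS_sub_enorm hT hg hgX n ht
  rw [← ofReal_mR hX, show (2:ℝ≥0∞) = ENNReal.ofReal 2 by simp,
    ← ENNReal.ofReal_mul (by norm_num), ← ofReal_norm] at this
  exact (ENNReal.ofReal_le_ofReal_iff (mul_nonneg (by norm_num) (mR_nonneg _ _ _ _))).1 this

lemma pS_lip_abs {X : ℝ → V} (hX : Continuous X) {T : ℝ} (hT : 0 < T) {g : ℝ → ℝ}
    (hg : Continuous g) (hgX : ∀ z w, |g z - g w| ≤ ‖X z - X w‖) (n : ℕ) {t s : ℝ}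
    (ht : t ∈ Icc 0 T) (hs : s ∈ Icc 0 T) (hts : |t - s| ≤ eS T n) :
    |pS T g n t - pS T g n s| ≤ 4 * (|t - s| / eS T n) * mR X T n s := by
  have := pS_lip_enorm hT hg hgX n ht hs hts
  have he := eS_pos hT n
  rw [← ofReal_mR hX, ← ENNReal.ofReal_mul (by positivity), ← ofReal_norm] at this
  exact (ENNReal.ofReal_le_ofReal_iff (mul_nonneg (by positivity) (mR_nonneg _ _ _ _))).1 this

/-- cutoff weight -/
noncomputable def kap (T : ℝ) (n : ℕ) (r : ℝ) : ℝ := min 1 (√(r / eS T n))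

lemma kap_nonneg (T : ℝ) (n : ℕ) (r : ℝ) : 0 ≤ kap T n r := le_min (by norm_num) (Real.sqrt_nonneg _)

/-- the `n`th block of the paraproduct remainder -/
lemma term_bound {X : ℝ → V} (hX : Continuous X) {T : ℝ} (hT : 0 < T) {f g : ℝ → ℝ}
    (hf : Continuous f) (hfX : ∀ z w, |f z - f w| ≤ ‖X z - X w‖)
    (hg : Continuous g) (hgX : ∀ z w, |g z - g w| ≤ ‖X z - X w‖) (n : ℕ) {t s : ℝ}
    (ht : t ∈ Icc 0 T) (hs : s ∈ Icc 0 T) :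
    |(pS T f n t - f s) * (pS T g (n + 1) t - pS T g n t)
      - (pS T f n s - f s) * (pS T g (n + 1) s - pS T g n s)| ≤
    100 * ((kap T n |t - s| * (mR X T n s + mR X T n t)) ^ 2
      + ‖X t - X s‖ * (kap T n |t - s| * (mR X T n s + mR X T n t))) := by
  have he := eS_pos hT n
  set r := |t - s| with hr
  have hr0 : 0 ≤ r := abs_nonneg _
  set κ := kap T n r with hκ
  set μs := mR X T n s with hμs
  set μt := mR X T n t with hμt
  have hs0 : 0 ≤ μs := mR_nonneg _ _ _ _
  have ht0 : 0 ≤ μt := mR_nonneg _ _ _ _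
  have hκ0 : 0 ≤ κ := kap_nonneg _ _ _
  have hΔ : ∀ {x : ℝ}, x ∈ Icc 0 T → |pS T g (n + 1) x - pS T g n x| ≤ 6 * mR X T n x := by
    intro x hx
    have h1 := pS_sub_abs hX hT hg hgX (n + 1) hx
    have h2 := pS_sub_abs hX hT hg hgX n hx
    have h3 := mR_succ_le hX hT n x
    rw [abs_le] at *
    constructor <;> linarith [h1.1, h1.2, h2.1, h2.2]
  have hΔt := hΔ ht
  have hΔs := hΔ hs
  have hft := pS_sub_abs hX hT hf hfX n ht
  have hfs := pS_sub_abs hX hT hf hfX n hs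
  have hx0 : 0 ≤ ‖X t - X s‖ := norm_nonneg _
  have hfts := hfX t s
  by_cases hc : r ≤ eS T n / 2
  · have hq0 : 0 ≤ r / eS T n := by positivity
    have hκ2 : κ ^ 2 = r / eS T n := by
      have h1 : r / eS T n ≤ 1 := by rw [div_le_one he]; linarith
      rw [hκ, kap, min_eq_right (by simpa using Real.sqrt_le_sqrt h1), Real.sq_sqrt hq0]
    have hpf := pS_lip_abs hX hT hf hfX n ht hs (by linarith)
    have hpg := pS_lip_abs hX hT hg hgX n ht hs (by linarith)
    have hpg1 := pS_lip_abs hX hT hg hgX (n + 1) ht hs (by rw [eS_succ]; exact hc)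
    rw [← hr, ← hμs] at hpf hpg
    rw [← hr, eS_succ, show r / (eS T n / 2) = 2 * (r / eS T n) by field_simp] at hpg1
    have h3 := mR_succ_le hX hT n s
    rw [← hκ2] at hpf hpg hpg1
    have hd : |(pS T g (n + 1) t - pS T g n t) - (pS T g (n + 1) s - pS T g n s)|
        ≤ 20 * κ ^ 2 * μs := by
      have h4 : 4 * (2 * κ ^ 2) * mR X T (n + 1) s ≤ 4 * (2 * κ ^ 2) * (2 * μs) := by gcongr
      rw [abs_le] at *
      constructor <;> linarith [hpg.1, hpg.2, hpg1.1, hpg1.2]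
    rw [show (pS T f n t - f s) * (pS T g (n + 1) t - pS T g n t)
      - (pS T f n s - f s) * (pS T g (n + 1) s - pS T g n s)
      = (pS T f n t - pS T f n s) * (pS T g (n + 1) t - pS T g n t)
      + (pS T f n s - f s) *
        ((pS T g (n + 1) t - pS T g n t) - (pS T g (n + 1) s - pS T g n s)) by ring]
    refine (abs_add_le _ _).trans ?_
    rw [abs_mul, abs_mul]
    calc _ ≤ (4 * κ ^ 2 * μs) * (6 * μt) + (2 * μs) * (20 * κ ^ 2 * μs) := by gcongr
      _ = κ ^ 2 * (24 * μs * μt + 40 * μs ^ 2) := by ring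
      _ ≤ κ ^ 2 * (100 * (μs + μt) ^ 2) := by
          gcongr; nlinarith [mul_nonneg hs0 ht0]
      _ = 100 * (κ * (μs + μt)) ^ 2 := by ring
      _ ≤ _ := by
          have : 0 ≤ ‖X t - X s‖ * (κ * (μs + μt)) := by positivity
          linarith
  · push Not at hc
    have hκ1 : 1 / 2 ≤ κ ^ 2 := by
      have h1 : 1 / 2 ≤ r / eS T n := by
        rw [le_div_iff₀ he]; linarith
      rw [hκ, kap]
      rcases min_choice (1:ℝ) (√(r / eS T n)) with h | h
      · rw [h]; norm_num
      · rw [h, Real.sq_sqrt (by positivity)]; exact h1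
    have hκ2 : κ ≤ 1 := min_le_left _ _
    have hκ3 : 1 / 2 ≤ κ := by nlinarith
    have hfst : |pS T f n t - f s| ≤ 2 * μt + ‖X t - X s‖ := by
      rw [abs_le] at *
      constructor <;> linarith [hft.1, hft.2, hfts.1, hfts.2]
    refine (abs_sub _ _).trans ?_
    rw [abs_mul, abs_mul]
    calc _ ≤ (2 * μt + ‖X t - X s‖) * (6 * μt) + (2 * μs) * (6 * μs) := by gcongr
      _ = 12 * (μt ^ 2 + μs ^ 2) + ‖X t - X s‖ * (6 * μt) := by ring
      _ ≤ 50 * (μs + μt) ^ 2 + ‖X t - X s‖ * (50 * (μs + μt)) := by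
          gcongr ?_ + _ * ?_
          · nlinarith [mul_nonneg hs0 ht0]
          · linarith
      _ = 100 * ((1 / 2) * (μs + μt) ^ 2 + ‖X t - X s‖ * ((1 / 2) * (μs + μt))) := by ring
      _ ≤ 100 * (κ ^ 2 * (μs + μt) ^ 2 + ‖X t - X s‖ * (κ * (μs + μt))) := by gcongr
      _ = _ := by ring

end


/-! ### Part D: the paraproduct -/

section
variable {V : Type*} [NormedAddCommGroup V]

lemma lintegral_kS {T : ℝ} (hT : 0 < T) (n : ℕ) {t : ℝ} (ht : t ∈ Icc 0 T) :
    ∫⁻ z in Icc 0 T, ‖kS T n t z‖ₑ = 1 := by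
  have h1 := kS_integral hT n ht
  have h2 : IntegrableOn (fun z => kS T n t z) (Icc 0 T) := by
    simpa using kS_integrable T n t (g := fun _ => 1) continuous_const
  have := ofReal_integral_eq_lintegral_ofReal h2 (ae_of_all _ fun z => kS_nonneg T n t z)
  rw [h1, ENNReal.ofReal_one] at this
  rw [this]
  refine lintegral_congr fun z => ?_
  rw [Real.enorm_eq_ofReal (kS_nonneg _ _ _ _)]

lemma young_aux {x A p : ℝ} (hx : 0 ≤ x) (hA : 0 < A) (hp : 1 < p) :
    x ≤ A + A ^ (1 - p) * x ^ p := by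
  rcases le_total x A with h | h
  · have : 0 ≤ A ^ (1 - p) * x ^ p := by positivity
    linarith
  · have hx0 : 0 < x := hA.trans_le h
    have h1 : A ^ (p - 1) ≤ x ^ (p - 1) := Real.rpow_le_rpow hA.le h (by linarith)
    have h2 : x = A ^ (1 - p) * (A ^ (p - 1) * x) := by
      rw [← mul_assoc, ← Real.rpow_add hA]; simp
    have h3 : x ^ p = x ^ (p - 1) * x := by
      rw [← Real.rpow_add_one hx0.ne']; simp
    have h4 : A ^ (1 - p) * (A ^ (p - 1) * x) ≤ A ^ (1 - p) * (x ^ (p - 1) * x) := by gcongr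
    rw [h3]; linarith

lemma delta_bound {X : ℝ → V} {T α p : ℝ} (hT : 0 < T) (hp : 1 < p)
    (hX : ∫⁻ u in Icc (0:ℝ) T, ∫⁻ v in Icc (0:ℝ) T,
        ENNReal.ofReal (‖X u - X v‖ ^ p / |v - u| ^ (α * p + 1)) < ⊤) (hα : 0 < α)
    {g : ℝ → ℝ} (hg : Continuous g) (hgX : ∀ z w, |g z - g w| ≤ ‖X z - X w‖) :
    ∃ C : ℝ, 0 ≤ C ∧ ∀ n, ∀ t ∈ Icc 0 T,
      |pS T g (n + 1) t - pS T g n t| ≤ C * (eS T n) ^ (α - 1 / p) := by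
  set J := ∫⁻ u in Icc (0:ℝ) T, ∫⁻ v in Icc (0:ℝ) T,
        ENNReal.ofReal (‖X u - X v‖ ^ p / |v - u| ^ (α * p + 1)) with hJ
  set γ := α * p + 1 with hγ
  set σ := α - 1 / p with hσ
  have hγ0 : 0 < γ := by positivity
  refine ⟨1 + 8 * 2 ^ γ * J.toReal, by positivity, ?_⟩
  intro n t ht
  have he := eS_pos hT n
  set e := eS T n with hee
  set A := e ^ σ with hA
  have hA0 : 0 < A := by positivity
  set D := 8 / e ^ 2 * A ^ (1 - p) * (2 * e) ^ γ with hD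
  have hD0 : 0 ≤ D := by positivity
  have hDe : D = 8 * 2 ^ γ * A := by
    rw [hD, hA, ← Real.rpow_mul he.le, Real.mul_rpow (by norm_num) he.le, ← Real.rpow_natCast e 2]
    have : e ^ σ = e ^ (-((2:ℕ):ℝ)) * e ^ (σ * (1 - p)) * e ^ γ := by
      rw [← Real.rpow_add he, ← Real.rpow_add he]
      congr 1
      rw [hσ, hγ]; push_cast; field_simp; ring
    rw [this, Real.rpow_neg he.le]
    ring
  have key : ‖pS T g (n + 1) t - pS T g n t‖ₑ ≤ ENNReal.ofReal A + ENNReal.ofReal D * J := by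
    rw [show pS T g (n + 1) t - pS T g n t = - (pS T g n t - pS T g (n + 1) t) by ring, enorm_neg,
      pS_sub hT hg n ht]
    refine (enorm_integral_le_lintegral_enorm _).trans ?_
    have step : ∀ w ∈ Icc 0 T, ‖kS T n t w * (g w - pS T g (n + 1) t)‖ₑ ≤
        ‖kS T n t w‖ₑ * ENNReal.ofReal A + ENNReal.ofReal D *
          ∫⁻ z in Icc 0 T, ENNReal.ofReal (‖X w - X z‖ ^ p / |z - w| ^ γ) := by
      intro w hw
      rw [enorm_mul, show g w - pS T g (n + 1) t = - (pS T g (n + 1) t - g w) by ring, enorm_neg,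
        pS_sub hT hg (n + 1) ht]
      calc _ ≤ ‖kS T n t w‖ₑ * ∫⁻ z in Icc 0 T, ‖kS T (n + 1) t z * (g z - g w)‖ₑ := by
            gcongr; exact enorm_integral_le_lintegral_enorm _
        _ = ∫⁻ z in Icc 0 T, ‖kS T n t w‖ₑ * ‖kS T (n + 1) t z * (g z - g w)‖ₑ := by
            rw [lintegral_const_mul' _ _ enorm_ne_top]
        _ ≤ ∫⁻ z in Icc 0 T, (‖kS T n t w‖ₑ * ENNReal.ofReal A * ‖kS T (n + 1) t z‖ₑ
              + ENNReal.ofReal D * ENNReal.ofReal (‖X w - X z‖ ^ p / |z - w| ^ γ)) := by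
            refine lintegral_mono fun z => ?_
            rw [← enorm_mul, Real.enorm_eq_ofReal_abs, Real.enorm_eq_ofReal (kS_nonneg _ _ _ _),
              Real.enorm_eq_ofReal (kS_nonneg _ _ _ _), ← ENNReal.ofReal_mul (kS_nonneg _ _ _ _),
              ← ENNReal.ofReal_mul (mul_nonneg (kS_nonneg _ _ _ _) hA0.le),
              ← ENNReal.ofReal_mul hD0, ← ENNReal.ofReal_add
                (mul_nonneg (mul_nonneg (kS_nonneg _ _ _ _) hA0.le) (kS_nonneg _ _ _ _))
                (by positivity)]
            apply ENNReal.ofReal_le_ofReal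
            have k0 := kS_nonneg T n t w
            have k1 := kS_nonneg T (n + 1) t z
            rw [abs_mul, abs_mul, abs_of_nonneg k0, abs_of_nonneg k1]
            have kle0 := kS_le hT n t w
            have kle1 := kS_le hT (n + 1) t z
            rw [eS_succ] at kle1
            by_cases hsupp : |w - t| ≤ e ∧ |z - t| ≤ e / 2
            · have hzw : |z - w| ≤ 2 * e := by
                have := abs_sub_le z t w
                rw [abs_sub_comm t w] at this
                linarith
              have h1 : |g z - g w| ≤ A + A ^ (1 - p) * ‖X w - X z‖ ^ p := by
                refine (hgX z w).trans ?_
                rw [norm_sub_rev]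
                exact young_aux (norm_nonneg _) hA0 hp
              have h2 : ‖X w - X z‖ ^ p ≤ (2 * e) ^ γ * (‖X w - X z‖ ^ p / |z - w| ^ γ) := by
                by_cases hz : z = w
                · subst hz; simp [Real.zero_rpow (by linarith : p ≠ 0)]
                have hpos : 0 < |z - w| := abs_pos.2 (sub_ne_zero.2 hz)
                have h3 : |z - w| ^ γ ≤ (2 * e) ^ γ := Real.rpow_le_rpow hpos.le hzw hγ0.le
                have h4 : 0 < |z - w| ^ γ := by positivity
                rw [mul_div_assoc', le_div_iff₀ h4, mul_comm]
                gcongr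
              calc _ ≤ kS T n t w * (kS T (n + 1) t z * (A + A ^ (1 - p) *
                        ((2 * e) ^ γ * (‖X w - X z‖ ^ p / |z - w| ^ γ)))) := by
                    gcongr
                    exact h1.trans (by gcongr)
                _ = kS T n t w * A * kS T (n + 1) t z + kS T n t w * kS T (n + 1) t z * A ^ (1 - p) *
                        ((2 * e) ^ γ * (‖X w - X z‖ ^ p / |z - w| ^ γ)) := by ring
                _ ≤ kS T n t w * A * kS T (n + 1) t z + (2 / e) * (2 / (e / 2)) * A ^ (1 - p) *
                        ((2 * e) ^ γ * (‖X w - X z‖ ^ p / |z - w| ^ γ)) := by gcongr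
                _ = _ := by rw [hD]; field_simp; ring
            · have hz : kS T n t w * kS T (n + 1) t z = 0 := by
                rcases not_and_or.1 hsupp with h | h
                · rw [kS_supp n ht (by push Not at h; exact h), zero_mul]
                · rw [kS_supp (n + 1) ht (by push Not at h; rw [eS_succ]; exact h), mul_zero]
              rw [← mul_assoc, hz, zero_mul]
              positivity
        _ = _ := by
            rw [lintegral_add_left, lintegral_const_mul' _ _ (by finiteness),
              lintegral_const_mul' _ _ (by finiteness), lintegral_kS hT (n + 1) ht, mul_one]
            apply Measurable.const_mul
            exact (((continuous_kS T (n + 1)).comp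
              (by fun_prop : Continuous fun z : ℝ => (t, z))).enorm).measurable
    refine (setLIntegral_mono' measurableSet_Icc step).trans (le_of_eq ?_)
    rw [lintegral_add_left, lintegral_mul_const' _ _ (by finiteness),
      lintegral_const_mul' _ _ (by finiteness), lintegral_kS hT n ht, one_mul]
    apply Measurable.mul_const
    exact (((continuous_kS T n).comp
      (by fun_prop : Continuous fun z : ℝ => (t, z))).enorm).measurable
  rw [← ENNReal.ofReal_toReal hX.ne, ← ENNReal.ofReal_mul hD0, ← ENNReal.ofReal_add hA0.le
    (by positivity), Real.enorm_eq_ofReal_abs, ENNReal.ofReal_le_ofReal_iff (by positivity)] at key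
  calc _ ≤ _ := key
    _ = _ := by rw [hDe]; ring

lemma continuous_pS (T : ℝ) {g : ℝ → ℝ} (hg : Continuous g) (n : ℕ) : Continuous (pS T g n) := by
  unfold pS
  refine continuous_parametric_integral_of_continuous ?_ isCompact_Icc
  exact (continuous_kS T n).mul (hg.comp continuous_snd)

lemma pS_bdd {T : ℝ} (hT : 0 < T) {g : ℝ → ℝ} (hg : Continuous g) :
    ∃ B : ℝ, 0 ≤ B ∧ ∀ n, ∀ t ∈ Icc 0 T, |pS T g n t| ≤ B := by
  obtain ⟨B, hB⟩ := (isCompact_Icc (a := (0:ℝ)) (b := T)).exists_bound_of_continuousOn hg.continuousOn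
  have hB0 : 0 ≤ B := (norm_nonneg _).trans (hB 0 ⟨le_rfl, hT.le⟩)
  refine ⟨B, hB0, fun n t ht => ?_⟩
  have h1 : ‖∫ z in Icc 0 T, kS T n t z * g z‖ ≤ ∫ z in Icc 0 T, kS T n t z * B := by
    apply norm_integral_le_of_norm_le (kS_integrable T n t continuous_const)
    refine (ae_restrict_iff' measurableSet_Icc).2 (ae_of_all _ fun z hz => ?_)
    rw [norm_mul, Real.norm_of_nonneg (kS_nonneg _ _ _ _)]
    exact mul_le_mul_of_nonneg_left (hB z hz) (kS_nonneg _ _ _ _)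
  rwa [integral_mul_const, kS_integral hT n ht, one_mul] at h1

lemma tendsto_eS (T : ℝ) : Filter.Tendsto (eS T) Filter.atTop (nhds 0) := by
  have h := (tendsto_pow_atTop_nhds_zero_of_lt_one (r := (1/2:ℝ)) (by norm_num)
    (by norm_num)).const_mul T
  rw [mul_zero] at h
  refine h.congr fun n => ?_
  unfold eS; rw [one_div, inv_pow, div_eq_mul_inv]

lemma tendsto_pS {T : ℝ} (hT : 0 < T) {g : ℝ → ℝ} (hg : Continuous g) {t : ℝ} (ht : t ∈ Icc 0 T) :
    Filter.Tendsto (fun n => pS T g n t) Filter.atTop (nhds (g t)) := by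
  rw [Metric.tendsto_atTop]
  intro ε hε
  obtain ⟨δ, hδ, hδ2⟩ := Metric.continuous_iff.1 hg t (ε / 2) (by positivity)
  obtain ⟨N, hN⟩ := (Metric.tendsto_atTop.1 (tendsto_eS T)) δ hδ
  refine ⟨N, fun n hn => ?_⟩
  have he := hN n hn
  have he0 := eS_pos hT n
  rw [Real.dist_eq, sub_zero, abs_of_pos he0] at he
  rw [Real.dist_eq, pS_sub hT hg n ht]
  have h1 : ‖∫ z in Icc 0 T, kS T n t z * (g z - g t)‖ ≤ ∫ z in Icc 0 T, kS T n t z * (ε / 2) := by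
    apply norm_integral_le_of_norm_le (kS_integrable T n t continuous_const)
    refine ae_of_all _ fun z => ?_
    rw [norm_mul, Real.norm_of_nonneg (kS_nonneg _ _ _ _)]
    by_cases hz : |z - t| ≤ eS T n
    · have := hδ2 z (by rw [Real.dist_eq]; linarith)
      rw [Real.dist_eq] at this
      exact mul_le_mul_of_nonneg_left this.le (kS_nonneg _ _ _ _)
    · rw [kS_supp n ht (by push Not at hz; exact hz)]; simp
  rw [integral_mul_const, kS_integral hT n ht, one_mul] at h1
  rw [← Real.norm_eq_abs]; linarith

lemma summable_eS {T σ : ℝ} (hT : 0 < T) (hσ : 0 < σ) : Summable fun n => (eS T n) ^ σ := by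
  have : ∀ n, (eS T n) ^ σ = T ^ σ * (((1/2:ℝ) ^ σ) ^ n) := by
    intro n
    unfold eS
    rw [div_eq_mul_inv, ← inv_pow, Real.mul_rpow hT.le (by positivity), ← Real.rpow_natCast,
      ← Real.rpow_mul (by norm_num), mul_comm (n:ℝ), Real.rpow_mul (by norm_num),
      Real.rpow_natCast, one_div]
  simp only [this]
  apply Summable.mul_left
  apply summable_geometric_of_lt_one (by positivity)
  exact Real.rpow_lt_one (by norm_num) (by norm_num) hσ

/-- weighted sum of oscillations -/
noncomputable def Usum (X : ℝ → V) (T : ℝ) (r s : ℝ) : ℝ≥0∞ :=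
  ∑' n, ENNReal.ofReal (kap T n r) * mE X T n s

lemma tsum_sq_le (x : ℕ → ℝ≥0∞) : ∑' n, x n ^ 2 ≤ (∑' n, x n) ^ 2 := by
  rw [sq, ← ENNReal.tsum_mul_right]
  refine ENNReal.tsum_le_tsum fun n => ?_
  rw [sq]
  gcongr
  exact ENNReal.le_tsum n

theorem paraproduct {X : ℝ → V} (hXc : Continuous X) {T α p : ℝ} (hT : 0 < T) (hp : 1 < p)
    (hα : 0 < α) (hαp : 1 / p < α)
    (hX : ∫⁻ u in Icc (0:ℝ) T, ∫⁻ v in Icc (0:ℝ) T,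
        ENNReal.ofReal (‖X u - X v‖ ^ p / |v - u| ^ (α * p + 1)) < ⊤)
    {f g : ℝ → ℝ} (hf : Continuous f) (hfX : ∀ z w, |f z - f w| ≤ ‖X z - X w‖)
    (hg : Continuous g) (hgX : ∀ z w, |g z - g w| ≤ ‖X z - X w‖) :
    ∃ h : ℝ → ℝ, ContinuousOn h (Icc 0 T) ∧ ∀ s ∈ Icc 0 T, ∀ t ∈ Icc 0 T,
      ‖h t - h s - f s * (g t - g s)‖ₑ ≤
        100 * (‖X t - X s‖ₑ + (Usum X T |t - s| s + Usum X T |t - s| t)) ^ 2 := by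
  obtain ⟨C, hC0, hC⟩ := delta_bound hT hp hX hα hg hgX
  obtain ⟨B, hB0, hB⟩ := pS_bdd hT hf
  have hσ : 0 < α - 1 / p := by linarith
  have hsum := summable_eS hT hσ
  have hb : ∀ n, ∀ t ∈ Icc 0 T, ‖pS T f n t * (pS T g (n + 1) t - pS T g n t)‖
      ≤ B * (C * eS T n ^ (α - 1 / p)) := by
    intro n t ht
    rw [norm_mul]
    exact mul_le_mul (hB n t ht) (hC n t ht) (norm_nonneg _) hB0
  have hsb : Summable fun n => B * (C * eS T n ^ (α - 1 / p)) := (hsum.mul_left C).mul_left B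
  refine ⟨fun t => ∑' n, pS T f n t * (pS T g (n + 1) t - pS T g n t), ?_, ?_⟩
  · refine continuousOn_tsum (fun n => ?_) hsb hb
    exact ((continuous_pS T hf n).mul
      ((continuous_pS T hg (n + 1)).sub (continuous_pS T hg n))).continuousOn
  · intro s hs t ht
    have hS1 : ∀ x ∈ Icc 0 T, Summable fun n => pS T f n x * (pS T g (n + 1) x - pS T g n x) :=
      fun x hx => Summable.of_norm_bounded hsb (fun n => hb n x hx)
    have hS2 : ∀ x ∈ Icc 0 T, HasSum (fun n => (pS T g (n + 1) x - pS T g n x))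
        (g x - pS T g 0 x) := by
      intro x hx
      have h1 : Summable fun n => (pS T g (n + 1) x - pS T g n x) :=
        Summable.of_norm_bounded (hsum.mul_left C) (fun n => hC n x hx)
      have h2 := h1.hasSum.tendsto_sum_nat
      simp only [Finset.sum_range_sub (fun n => pS T g n x)] at h2
      have h3 := (tendsto_pS hT hg hx).sub_const (pS T g 0 x)
      rw [← tendsto_nhds_unique h2 h3]
      exact h1.hasSum
    have h0 : pS T g 0 t = pS T g 0 s := by simp [pS, kS_zero]
    have hterm : HasSum (fun n => (pS T f n t - f s) * (pS T g (n + 1) t - pS T g n t)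
      - (pS T f n s - f s) * (pS T g (n + 1) s - pS T g n s))
      (∑' n, pS T f n t * (pS T g (n + 1) t - pS T g n t)
        - ∑' n, pS T f n s * (pS T g (n + 1) s - pS T g n s) - f s * (g t - g s)) := by
      have := (((hS1 t ht).hasSum.sub ((hS2 t ht).mul_left (f s)))).sub
        ((hS1 s hs).hasSum.sub ((hS2 s hs).mul_left (f s)))
      have e2 : (∑' n, pS T f n t * (pS T g (n + 1) t - pS T g n t)
        - ∑' n, pS T f n s * (pS T g (n + 1) s - pS T g n s) - f s * (g t - g s))
        = (∑' n, pS T f n t * (pS T g (n + 1) t - pS T g n t) - f s * (g t - pS T g 0 t))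
          - (∑' n, pS T f n s * (pS T g (n + 1) s - pS T g n s) - f s * (g s - pS T g 0 s)) := by
        rw [h0]; ring
      rw [e2]
      refine Eq.subst (motive := fun F : ℕ → ℝ => HasSum F _) (funext fun n => ?_) this
      ring
    simp only []
    rw [← hterm.tsum_eq]
    refine enorm_tsum_le_tsum_enorm.trans ?_
    set x : ℕ → ℝ≥0∞ := fun n => ENNReal.ofReal (kap T n |t - s|) * (mE X T n s + mE X T n t) with hx
    have hxU : ∑' n, x n = Usum X T |t - s| s + Usum X T |t - s| t := by
      simp only [hx, Usum, mul_add]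
      rw [ENNReal.tsum_add]
    calc _ ≤ ∑' n, 100 * (x n ^ 2 + ‖X t - X s‖ₑ * x n) := by
          refine ENNReal.tsum_le_tsum fun n => ?_
          have hb := term_bound hXc hT hf hfX hg hgX n ht hs
          rw [Real.enorm_eq_ofReal_abs]
          refine (ENNReal.ofReal_le_ofReal hb).trans (le_of_eq ?_)
          have hk := kap_nonneg T n |t - s|
          have hms := mR_nonneg X T n s
          have hmt := mR_nonneg X T n t
          rw [ENNReal.ofReal_mul (by norm_num), ENNReal.ofReal_add (by positivity) (by positivity),
            ENNReal.ofReal_pow (by positivity), ENNReal.ofReal_mul (norm_nonneg _),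
            ENNReal.ofReal_mul hk, ENNReal.ofReal_add hms hmt, ofReal_mR hXc, ofReal_mR hXc,
            ofReal_norm]
          simp [hx]
      _ = 100 * (∑' n, x n ^ 2 + ‖X t - X s‖ₑ * ∑' n, x n) := by
          rw [ENNReal.tsum_mul_left, ENNReal.tsum_add, ENNReal.tsum_mul_left]
      _ ≤ 100 * ((∑' n, x n) ^ 2 + ‖X t - X s‖ₑ * ∑' n, x n) := by
          gcongr; exact tsum_sq_le x
      _ ≤ _ := by
          rw [← hxU]
          gcongr
          set S := ∑' n, x n
          set y := ‖X t - X s‖ₑ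
          calc S ^ 2 + y * S ≤ S ^ 2 + y * S + (y ^ 2 + y * S) := le_self_add
            _ = _ := by ring

end

/-! ### Part E: integral bound -/

section

lemma dyadic_sum {a b : ℝ} (ha : 0 < a) (hb : 0 < b) : ∃ C : ℝ≥0∞, C < ⊤ ∧ ∀ x : ℝ, 0 < x →
    ∑' n : ℕ, ENNReal.ofReal (min ((x / 2 ^ n) ^ a) ((x / 2 ^ n) ^ (-b))) ≤ C := by
  set w : ℤ → ℝ≥0∞ := fun j => ENNReal.ofReal (min ((2:ℝ) ^ (a * (1 - j))) ((2:ℝ) ^ (b * j))) with hw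
  have hgeo : ∀ c : ℝ, 0 < c → ∀ K : ℝ, ∑' n : ℕ, ENNReal.ofReal (K * ((2:ℝ) ^ (-c)) ^ n) < ⊤ := by
    intro c hc K
    refine Summable.tsum_ofReal_lt_top ?_
    refine (summable_geometric_of_lt_one (by positivity) ?_).mul_left K
    exact Real.rpow_lt_one_of_one_lt_of_neg (by norm_num) (by linarith)
  refine ⟨∑' j, w j, ?_, ?_⟩
  · rw [tsum_of_nat_of_neg_add_one ENNReal.summable ENNReal.summable]
    refine ENNReal.add_lt_top.2 ⟨?_, ?_⟩
    · refine lt_of_le_of_lt (ENNReal.tsum_le_tsum fun n => ?_) (hgeo a ha ((2:ℝ) ^ a))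
      refine ENNReal.ofReal_le_ofReal ((min_le_left _ _).trans (le_of_eq ?_))
      rw [← Real.rpow_mul_natCast (by norm_num), ← Real.rpow_add (by norm_num)]
      congr 1; push_cast; ring
    · refine lt_of_le_of_lt (ENNReal.tsum_le_tsum fun n => ?_) (hgeo b hb ((2:ℝ) ^ (-b)))
      refine ENNReal.ofReal_le_ofReal ((min_le_right _ _).trans (le_of_eq ?_))
      rw [← Real.rpow_mul_natCast (by norm_num), ← Real.rpow_add (by norm_num)]
      congr 1; push_cast; ring
  · intro x hx
    obtain ⟨k, hk1, hk2⟩ := exists_mem_Ico_zpow hx (by norm_num : (1:ℝ) < 2)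
    refine le_trans ?_ (ENNReal.tsum_comp_le_tsum_of_injective
      (f := fun n : ℕ => (n : ℤ) - k) (fun m n h => by simpa using h) w)
    refine ENNReal.tsum_le_tsum fun n => ?_
    simp only [hw]
    rw [← Real.rpow_intCast] at hk1 hk2
    have e1 : x / 2 ^ n = x * (2:ℝ) ^ (-(n:ℝ)) := by
      rw [Real.rpow_neg (by norm_num), Real.rpow_natCast]; rfl
    have u1 : x / 2 ^ n ≤ (2:ℝ) ^ (1 - ((n:ℝ) - k)) := by
      rw [e1, show (1 - ((n:ℝ) - k)) = ((k + 1 : ℤ) : ℝ) + (-(n:ℝ)) by push_cast; ring,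
        Real.rpow_add (by norm_num)]
      gcongr
    have u2 : (2:ℝ) ^ (-((n:ℝ) - k)) ≤ x / 2 ^ n := by
      rw [e1, show (-((n:ℝ) - k)) = (k : ℝ) + (-(n:ℝ)) by push_cast; ring,
        Real.rpow_add (by norm_num)]
      gcongr
    refine ENNReal.ofReal_le_ofReal (min_le_min ?_ ?_)
    · rw [mul_comm, Real.rpow_mul (by norm_num)]
      push_cast
      exact Real.rpow_le_rpow (by positivity) u1 ha.le
    · rw [show b * (((n:ℤ) - k : ℤ) : ℝ) = (-((n:ℝ) - k)) * (-b) by push_cast; ring,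
        Real.rpow_mul (by norm_num)]
      exact Real.rpow_le_rpow_of_nonpos (by positivity) u2 (by linarith)

lemma tsum_jensen {p : ℝ} (hp : 1 < p) (w x : ℕ → ℝ≥0∞) :
    (∑' n, w n * x n) ^ p ≤ (∑' n, w n) ^ (p - 1) * ∑' n, w n * x n ^ p := by
  have hp0 : 0 < p := by linarith
  have h1 : ∑' n, w n * x n ≤ (∑' n, w n) ^ (1 - p⁻¹) * (∑' n, w n * x n ^ p) ^ p⁻¹ := by
    rw [ENNReal.tsum_eq_iSup_sum]
    refine iSup_le fun s => ?_
    refine (ENNReal.inner_le_weight_mul_Lp_of_nonneg s hp.le w x).trans ?_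
    have : 0 ≤ 1 - p⁻¹ := by
      have := inv_lt_one_of_one_lt₀ hp; linarith
    exact mul_le_mul' (ENNReal.rpow_le_rpow (ENNReal.sum_le_tsum s) this)
      (ENNReal.rpow_le_rpow (ENNReal.sum_le_tsum s) (by positivity))
  refine (ENNReal.rpow_le_rpow h1 hp0.le).trans (le_of_eq ?_)
  rw [ENNReal.mul_rpow_of_nonneg _ _ hp0.le, ← ENNReal.rpow_mul, ← ENNReal.rpow_mul]
  congr 2
  · field_simp
  · rw [inv_mul_cancel₀ hp0.ne', ENNReal.rpow_one]

lemma lintegral_jensen {p : ℝ} (hp : 1 < p) (μ : Measure ℝ) {f : ℝ → ℝ≥0∞} (hf : Measurable f) :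
    (∫⁻ z, f z ∂μ) ^ p ≤ (μ univ) ^ (p - 1) * ∫⁻ z, f z ^ p ∂μ := by
  have hp0 : 0 < p := by linarith
  have hc := Real.HolderConjugate.conjExponent hp
  have h1 := ENNReal.lintegral_mul_le_Lp_mul_Lq μ hc hf.aemeasurable
    (aemeasurable_const (b := (1:ℝ≥0∞)))
  simp only [Pi.mul_apply, mul_one, ENNReal.one_rpow, lintegral_one] at h1
  refine (ENNReal.rpow_le_rpow h1 hp0.le).trans (le_of_eq ?_)
  rw [ENNReal.mul_rpow_of_nonneg _ _ hp0.le, ← ENNReal.rpow_mul, ← ENNReal.rpow_mul, mul_comm]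
  congr 2
  · unfold Real.conjExponent; field_simp
  · rw [one_div, inv_mul_cancel₀ hp0.ne', ENNReal.rpow_one]

lemma kap_sum {α T : ℝ} (hT : 0 < T) (hα : 0 < α) (hα2 : α < 1 / 2) : ∃ C : ℝ≥0∞, C < ⊤ ∧
    ∀ r : ℝ, 0 < r → ∑' n, ENNReal.ofReal (eS T n ^ α * kap T n r) ≤ C * ENNReal.ofReal (r ^ α) := by
  obtain ⟨C, hC, h⟩ := dyadic_sum hα (by linarith : 0 < 1 / 2 - α)
  refine ⟨C, hC, fun r hr => ?_⟩
  refine le_trans (le_of_eq ?_) (mul_le_mul_left (h (T / r) (by positivity)) _)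
  rw [← ENNReal.tsum_mul_right]
  congr 1; ext n
  have he := eS_pos hT n
  have e1 : T / r / 2 ^ n = eS T n / r := by unfold eS; field_simp
  rw [e1, ← ENNReal.ofReal_mul (by positivity)]
  congr 1
  have e2 : eS T n ^ α = (eS T n / r) ^ α * r ^ α := by
    rw [← Real.mul_rpow (by positivity) hr.le]; congr 1; field_simp
  have e3 : √(r / eS T n) = (eS T n / r) ^ (-(1/2:ℝ)) := by
    rw [Real.sqrt_eq_rpow, Real.rpow_neg (by positivity), ← Real.inv_rpow (by positivity), inv_div]
  unfold kap
  rw [e2, e3, show -(1 / 2 - α) = α + (-(1/2:ℝ)) by ring, Real.rpow_add (by positivity)]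
  rw [mul_right_comm]
  congr 1
  rw [mul_min_of_nonneg _ _ (by positivity), mul_one]

lemma ind_sum {γ T : ℝ} (hT : 0 < T) (hγ : 0 < γ) : ∃ C : ℝ≥0∞, C < ⊤ ∧
    ∀ x : ℝ, 0 < x → ∑' n, (if x ≤ 2 * eS T n then ENNReal.ofReal (eS T n ^ (-γ)) else 0)
      ≤ C * ENNReal.ofReal (x ^ γ)⁻¹ := by
  obtain ⟨C, hC, h⟩ := dyadic_sum hγ hγ
  refine ⟨ENNReal.ofReal (4 ^ γ) * C, ENNReal.mul_lt_top ENNReal.ofReal_lt_top hC, fun x hx => ?_⟩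
  refine le_trans ?_ (mul_le_mul_left (mul_le_mul_right (h (T / x) (by positivity)) _) _)
  rw [← ENNReal.tsum_mul_left, ← ENNReal.tsum_mul_right]
  refine ENNReal.tsum_le_tsum fun n => ?_
  split_ifs with hn
  swap
  · exact zero_le
  have he := eS_pos hT n
  have e1 : T / x / 2 ^ n = eS T n / x := by unfold eS; field_simp
  rw [e1, ← ENNReal.ofReal_mul (by positivity), ← ENNReal.ofReal_mul (by positivity)]
  apply ENNReal.ofReal_le_ofReal
  have e2 : eS T n ^ (-γ) = (eS T n / x) ^ (-γ) * (x ^ γ)⁻¹ := by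
    rw [← Real.rpow_neg hx.le, ← Real.mul_rpow (by positivity) hx.le]; congr 1; field_simp
  rw [e2]
  refine mul_le_mul_of_nonneg_right ?_ (by positivity)
  rw [mul_min_of_nonneg _ _ (by positivity)]
  have hu : 1 / 2 ≤ eS T n / x := by rw [le_div_iff₀ hx]; linarith
  set u := eS T n / x
  have hu0 : 0 < u := by linarith
  refine le_min ?_ ?_
  · rw [Real.rpow_neg hu0.le, ← Real.inv_rpow hu0.le, ← Real.mul_rpow (by norm_num) hu0.le]
    refine Real.rpow_le_rpow (by positivity) ?_ hγ.le
    rw [inv_le_iff_one_le_mul₀ hu0]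
    nlinarith
  · refine le_mul_of_one_le_left (by positivity) ?_
    exact Real.one_le_rpow (by norm_num) hγ.le

end


section
variable {V : Type*} [NormedAddCommGroup V]

lemma measurable_kap (T : ℝ) (n : ℕ) : Measurable (kap T n) := by
  unfold kap; fun_prop

lemma kap_int_Ioi {α T : ℝ} (hT : 0 < T) (hα : 0 < α) (hα2 : α < 1 / 2) (n : ℕ) :
    ∫⁻ r in Ioi (0:ℝ), ENNReal.ofReal (r ^ (-α - 1) * kap T n r * eS T n ^ α)
      ≤ ENNReal.ofReal ((1 / 2 - α)⁻¹) + ENNReal.ofReal α⁻¹ := by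
  have he := eS_pos hT n
  set e := eS T n with hedef
  have hsplit : Ioi (0:ℝ) = Ioc 0 e ∪ Ioi e := (Ioc_union_Ioi_eq_Ioi he.le).symm
  rw [hsplit]
  refine (lintegral_union_le _ _ _).trans (add_le_add ?_ ?_)
  · have hi : IntegrableOn (fun r : ℝ => e ^ (α - 1/2) * r ^ (-α - 1/2)) (Ioc 0 e) := by
      have := (intervalIntegral.intervalIntegrable_rpow' (a := 0) (b := e)
        (by linarith : -1 < -α - 1/2)).const_mul (e ^ (α - 1/2))
      rwa [intervalIntegrable_iff_integrableOn_Ioc_of_le he.le] at this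
    calc _ ≤ ∫⁻ r in Ioc 0 e, ENNReal.ofReal (e ^ (α - 1/2) * r ^ (-α - 1/2)) := by
          refine setLIntegral_mono' measurableSet_Ioc fun r hr => ?_
          have hr0 := hr.1
          apply ENNReal.ofReal_le_ofReal
          have h1 : kap T n r ≤ r ^ (1/2:ℝ) * e ^ (-(1/2:ℝ)) := by
            refine (min_le_right _ _).trans (le_of_eq ?_)
            rw [Real.sqrt_eq_rpow, Real.div_rpow hr0.le he.le, Real.rpow_neg he.le]; rfl
          calc _ ≤ r ^ (-α - 1) * (r ^ (1/2:ℝ) * e ^ (-(1/2:ℝ))) * e ^ α := by gcongr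
            _ = (e ^ α * e ^ (-(1/2:ℝ))) * (r ^ (-α - 1) * r ^ (1/2:ℝ)) := by ring
            _ = _ := by
              rw [← Real.rpow_add he, ← Real.rpow_add hr0]; congr 2; ring
      _ = ENNReal.ofReal (∫ r in Ioc 0 e, e ^ (α - 1/2) * r ^ (-α - 1/2)) := by
          rw [ofReal_integral_eq_lintegral_ofReal hi]
          filter_upwards [ae_restrict_mem measurableSet_Ioc] with r hr
          have := hr.1
          simp only [Pi.zero_apply]; positivity
      _ = ENNReal.ofReal ((1 / 2 - α)⁻¹) := by
          congr 1
          rw [← intervalIntegral.integral_of_le he.le, intervalIntegral.integral_const_mul,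
            integral_rpow (Or.inl (by linarith)), Real.zero_rpow (by linarith), sub_zero,
            ← mul_div_assoc, ← Real.rpow_add he]
          rw [show α - 1/2 + (-α - 1/2 + 1) = 0 by ring, Real.rpow_zero, one_div]
          congr 1; ring
  · have hi : IntegrableOn (fun r : ℝ => e ^ α * r ^ (-α - 1)) (Ioi e) :=
      (integrableOn_Ioi_rpow_of_lt (by linarith) he).const_mul _
    calc _ ≤ ∫⁻ r in Ioi e, ENNReal.ofReal (e ^ α * r ^ (-α - 1)) := by
          refine setLIntegral_mono' measurableSet_Ioi fun r hr => ?_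
          have hr0 : 0 < r := he.trans hr
          apply ENNReal.ofReal_le_ofReal
          calc _ ≤ r ^ (-α - 1) * 1 * e ^ α := by gcongr; exact min_le_left _ _
            _ = _ := by ring
      _ = ENNReal.ofReal (∫ r in Ioi e, e ^ α * r ^ (-α - 1)) := by
          rw [ofReal_integral_eq_lintegral_ofReal hi]
          filter_upwards [ae_restrict_mem measurableSet_Ioi] with r hr
          have : 0 < r := he.trans hr
          simp only [Pi.zero_apply]; positivity
      _ = ENNReal.ofReal α⁻¹ := by
          congr 1
          rw [integral_const_mul, integral_Ioi_rpow_of_lt (by linarith) he]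
          rw [show -α - 1 + 1 = -α by ring, neg_div_neg_eq, ← mul_div_assoc, ← Real.rpow_add he]
          simp

lemma kap_int {α T : ℝ} (hT : 0 < T) (hα : 0 < α) (hα2 : α < 1 / 2) : ∃ C : ℝ≥0∞, C < ⊤ ∧
    ∀ n s, ∫⁻ t, ENNReal.ofReal (|t - s| ^ (-α - 1) * kap T n |t - s| * eS T n ^ α) ≤ C := by
  refine ⟨2 * (ENNReal.ofReal ((1 / 2 - α)⁻¹) + ENNReal.ofReal α⁻¹), ?_, fun n s => ?_⟩
  · exact ENNReal.mul_lt_top (by simp) (by simp)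
  have h0 := kap_int_Ioi hT hα hα2 n
  set F : ℝ → ℝ≥0∞ := fun r => ENNReal.ofReal (r ^ (-α - 1) * kap T n r * eS T n ^ α)
  rw [lintegral_sub_right_eq_self (fun t => F |t|) s, ← lintegral_add_compl _ (measurableSet_Ioi (a := (0:ℝ))),
    two_mul]
  refine add_le_add ?_ ?_
  · refine le_trans (le_of_eq ?_) h0
    refine setLIntegral_congr_fun measurableSet_Ioi fun r hr => ?_
    simp only [abs_of_pos (mem_Ioi.1 hr), F]
  · rw [compl_Ioi, ← setLIntegral_congr Iio_ae_eq_Iic]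
    have h2 := (Measure.measurePreserving_neg (volume : Measure ℝ)).setLIntegral_comp_preimage_emb
      (MeasurableEquiv.neg ℝ).measurableEmbedding (fun t => F |t|) (Iio 0)
    rw [← h2]
    refine le_trans (le_of_eq ?_) h0
    have : (Neg.neg ⁻¹' Iio 0 : Set ℝ) = Ioi 0 := by ext; simp
    rw [this]
    refine setLIntegral_congr_fun measurableSet_Ioi fun r hr => ?_
    simp only [abs_neg, abs_of_pos (mem_Ioi.1 hr), F]

lemma mE_rpow_le {X : ℝ → V} (hXc : Continuous X) {T p : ℝ} (hT : 0 < T) (hp : 1 < p) (n : ℕ) (s : ℝ) :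
    mE X T n s ^ p ≤ ENNReal.ofReal (4 ^ (p - 1)) * (ENNReal.ofReal (eS T n)⁻¹ *
      ∫⁻ z in Icc 0 T, (if |z - s| ≤ 2 * eS T n then 1 else 0) * ‖X z - X s‖ₑ ^ p) := by
  have he := eS_pos hT n
  have hp0 : 0 < p := by linarith
  set A : Set ℝ := {z : ℝ | |z - s| ≤ 2 * eS T n} with hA
  have hAm : MeasurableSet A := measurableSet_le (by fun_prop) (by fun_prop)
  have hm : Measurable fun z => ‖X z - X s‖ₑ := by
    have : Continuous fun z => ‖X z - X s‖ₑ := by fun_prop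
    exact this.measurable
  unfold mE
  rw [lintegral_indicator hAm, ENNReal.mul_rpow_of_nonneg _ _ hp0.le]
  have h1 := lintegral_jensen hp ((volume.restrict (Icc 0 T)).restrict A) hm
  have h2 : ((volume.restrict (Icc 0 T)).restrict A) univ ≤ ENNReal.ofReal (4 * eS T n) := by
    rw [Measure.restrict_apply_univ]
    refine (Measure.restrict_apply_le _ _).trans ?_
    have : A ⊆ Icc (s - 2 * eS T n) (s + 2 * eS T n) := by
      intro z hz
      have := abs_le.1 (show |z - s| ≤ 2 * eS T n from hz)
      constructor <;> linarith
    refine (measure_mono this).trans ?_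
    rw [Real.volume_Icc]
    apply ENNReal.ofReal_le_ofReal; linarith
  have h3 : ∫⁻ z in Icc 0 T, (if |z - s| ≤ 2 * eS T n then 1 else 0) * ‖X z - X s‖ₑ ^ p
      = ∫⁻ z, ‖X z - X s‖ₑ ^ p ∂((volume.restrict (Icc 0 T)).restrict A) := by
    rw [← lintegral_indicator hAm]
    congr 1; ext z
    by_cases hz : |z - s| ≤ 2 * eS T n
    · rw [indicator_of_mem (show z ∈ A from hz)]; simp [hz]
    · rw [indicator_of_notMem (show z ∉ A from hz)]; simp [hz]
  rw [h3]
  calc _ ≤ ENNReal.ofReal (eS T n)⁻¹ ^ p * (ENNReal.ofReal (4 * eS T n) ^ (p - 1) *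
        ∫⁻ z, ‖X z - X s‖ₑ ^ p ∂((volume.restrict (Icc 0 T)).restrict A)) := by
        refine mul_le_mul_right (h1.trans (mul_le_mul_left ?_ _)) _
        exact ENNReal.rpow_le_rpow h2 (by linarith)
    _ = _ := by
        rw [← mul_assoc, ← mul_assoc]
        congr 1
        rw [ENNReal.ofReal_rpow_of_nonneg (by positivity) hp0.le,
          ENNReal.ofReal_rpow_of_nonneg (by positivity) (by linarith),
          ← ENNReal.ofReal_mul (by positivity), ← ENNReal.ofReal_mul (by positivity)]
        congr 1
        rw [Real.mul_rpow (by norm_num) he.le, Real.inv_rpow he.le, ← Real.rpow_neg he.le]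
        rw [mul_left_comm, ← Real.rpow_add he, ← Real.rpow_neg_one]
        congr 2; ring

lemma measurable_mE {X : ℝ → V} (hXc : Continuous X) (T : ℝ) (n : ℕ) : Measurable (mE X T n) := by
  unfold mE
  refine Measurable.const_mul ?_ _
  refine Measurable.lintegral_prod_right (f := fun t z =>
    {z : ℝ | |z - t| ≤ 2 * eS T n}.indicator (fun z => ‖X z - X t‖ₑ) z) ?_
  have hc : Continuous fun q : ℝ × ℝ => ‖X q.2 - X q.1‖ₑ := by fun_prop
  have hs : MeasurableSet {q : ℝ × ℝ | |q.2 - q.1| ≤ 2 * eS T n} :=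
    measurableSet_le (by fun_prop) (by fun_prop)
  exact hc.measurable.indicator hs

lemma measurable_Usum {X : ℝ → V} (hXc : Continuous X) (T : ℝ) :
    Measurable (fun q : ℝ × ℝ => Usum X T |q.2 - q.1| q.1) := by
  unfold Usum
  refine Measurable.tsum fun n => ?_
  refine Measurable.mul ?_ ((measurable_mE hXc T n).comp measurable_fst)
  exact ((measurable_kap T n).comp (by fun_prop)).ennreal_ofReal

end


section
variable {V : Type*} [NormedAddCommGroup V]

lemma Usum_pointwise {α T p : ℝ} (hT : 0 < T) (hα : 0 < α) (hα2 : α < 1 / 2) (hp : 1 < p) :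
    ∃ C : ℝ≥0∞, C < ⊤ ∧ ∀ (X : ℝ → V) (s t : ℝ),
      Usum X T |t - s| s ^ p * ENNReal.ofReal ((|t - s| ^ (α * p + 1))⁻¹) ≤
        C * ∑' n, ENNReal.ofReal (|t - s| ^ (-α - 1) * kap T n |t - s| * eS T n ^ α) *
          (ENNReal.ofReal (eS T n ^ (-(α * p))) * mE X T n s ^ p) := by
  have hp0 : 0 < p := by linarith
  obtain ⟨C, hC, h⟩ := kap_sum hT hα hα2
  refine ⟨C ^ (p - 1), ENNReal.rpow_lt_top_of_nonneg (by linarith) hC.ne, fun X s t => ?_⟩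
  rcases eq_or_ne t s with rfl | hts
  · have hγ : 0 < α * p + 1 := by positivity
    simp [Real.zero_rpow hγ.ne']
  have hr : 0 < |t - s| := abs_pos.2 (sub_ne_zero.2 hts)
  set r := |t - s|
  have e0 : Usum X T r s = ∑' n, ENNReal.ofReal (eS T n ^ α * kap T n r) *
      (ENNReal.ofReal (eS T n ^ (-α)) * mE X T n s) := by
    unfold Usum
    congr 1; ext n
    have he := eS_pos hT n
    have hk := kap_nonneg T n r
    rw [← mul_assoc, ← ENNReal.ofReal_mul (by positivity)]
    congr 2
    rw [mul_right_comm, ← Real.rpow_add he]; simp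
  rw [e0]
  refine (mul_le_mul_left (tsum_jensen hp _ _) _).trans ?_
  refine (mul_le_mul_left (mul_le_mul_left (ENNReal.rpow_le_rpow (h r hr) (by linarith)) _) _).trans
    (le_of_eq ?_)
  rw [ENNReal.mul_rpow_of_nonneg _ _ (by linarith : 0 ≤ p - 1), mul_assoc, mul_assoc]
  congr 1
  rw [ENNReal.ofReal_rpow_of_nonneg (by positivity) (by linarith),
    mul_comm _ (ENNReal.ofReal _), ← mul_assoc, ← ENNReal.ofReal_mul (by positivity),
    ← ENNReal.tsum_mul_left]
  congr 1; ext n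
  have he := eS_pos hT n
  have hk := kap_nonneg T n r
  rw [ENNReal.mul_rpow_of_nonneg _ _ hp0.le, ENNReal.ofReal_rpow_of_nonneg (by positivity) hp0.le,
    ← Real.rpow_mul he.le, neg_mul, ← mul_assoc, ← ENNReal.ofReal_mul (by positivity)]
  congr 2
  rw [← Real.rpow_neg hr.le, ← Real.rpow_mul hr.le, ← Real.rpow_add hr,
    show α * (p - 1) + -(α * p + 1) = -α - 1 by ring]
  ring

lemma Usum_int {X : ℝ → V} (hXc : Continuous X) {α T p : ℝ} (hT : 0 < T) (hα : 0 < α)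
    (hα2 : α < 1 / 2) (hp : 1 < p)
    (hX : ∫⁻ u in Icc (0:ℝ) T, ∫⁻ v in Icc (0:ℝ) T,
        ENNReal.ofReal (‖X u - X v‖ ^ p / |v - u| ^ (α * p + 1)) < ⊤) :
    ∫⁻ s in Icc (0:ℝ) T, ∫⁻ t in Icc (0:ℝ) T,
      Usum X T |t - s| s ^ p * ENNReal.ofReal ((|t - s| ^ (α * p + 1))⁻¹) < ⊤ := by
  have hp0 : 0 < p := by linarith
  have hγ : 0 < α * p + 1 := by positivity
  obtain ⟨C1, hC1, h1⟩ := Usum_pointwise (V := V) hT hα hα2 hp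
  obtain ⟨C2, hC2, h2⟩ := kap_int hT hα hα2
  obtain ⟨C3, hC3, h3⟩ := ind_sum hT hγ
  set C4 := ENNReal.ofReal (4 ^ (p - 1))
  have hC4 : C4 < ⊤ := ENNReal.ofReal_lt_top
  have key : ∀ s, ∫⁻ t in Icc (0:ℝ) T,
      Usum X T |t - s| s ^ p * ENNReal.ofReal ((|t - s| ^ (α * p + 1))⁻¹) ≤
      (C1 * C2 * C4 * C3) * ∫⁻ v in Icc (0:ℝ) T,
        ENNReal.ofReal (‖X s - X v‖ ^ p / |v - s| ^ (α * p + 1)) := by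
    intro s
    have hmk : ∀ n, Measurable fun t => ENNReal.ofReal
        (|t - s| ^ (-α - 1) * kap T n |t - s| * eS T n ^ α) := by
      intro n
      have : Measurable fun t => kap T n |t - s| := (measurable_kap T n).comp (by fun_prop)
      fun_prop
    have hmX : Measurable fun z => ‖X z - X s‖ₑ := by
      have : Continuous fun z => ‖X z - X s‖ₑ := by fun_prop
      exact this.measurable
    have hmi : ∀ n, Measurable fun z : ℝ => (if |z - s| ≤ 2 * eS T n then (1:ℝ≥0∞) else 0) := by
      intro n
      exact Measurable.ite (measurableSet_le (by fun_prop) (by fun_prop)) measurable_const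
        measurable_const
    calc _ ≤ ∫⁻ t in Icc (0:ℝ) T, C1 * ∑' n,
          ENNReal.ofReal (|t - s| ^ (-α - 1) * kap T n |t - s| * eS T n ^ α) *
          (ENNReal.ofReal (eS T n ^ (-(α * p))) * mE X T n s ^ p) :=
          lintegral_mono fun t => h1 X s t
      _ = C1 * ∑' n, (∫⁻ t in Icc (0:ℝ) T,
          ENNReal.ofReal (|t - s| ^ (-α - 1) * kap T n |t - s| * eS T n ^ α)) *
          (ENNReal.ofReal (eS T n ^ (-(α * p))) * mE X T n s ^ p) := by
          rw [lintegral_const_mul' _ _ hC1.ne, lintegral_tsum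
            (fun n => ((hmk n).mul_const _).aemeasurable)]
          congr 2; ext n
          rw [lintegral_mul_const _ (hmk n)]
      _ ≤ C1 * ∑' n, C2 * (ENNReal.ofReal (eS T n ^ (-(α * p))) * (C4 * (ENNReal.ofReal (eS T n)⁻¹ *
          ∫⁻ z in Icc 0 T, (if |z - s| ≤ 2 * eS T n then 1 else 0) * ‖X z - X s‖ₑ ^ p))) := by
          refine mul_le_mul_right (ENNReal.tsum_le_tsum fun n => ?_) _
          refine mul_le_mul' ((setLIntegral_le_lintegral _ _).trans (h2 n s)) ?_
          exact mul_le_mul_right (mE_rpow_le hXc hT hp n s) _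
      _ = C1 * C2 * C4 * ∑' n, ∫⁻ z in Icc 0 T,
          (if |z - s| ≤ 2 * eS T n then ENNReal.ofReal (eS T n ^ (-(α * p + 1))) else 0)
            * ‖X z - X s‖ₑ ^ p := by
          rw [← ENNReal.tsum_mul_left, ← ENNReal.tsum_mul_left]
          refine tsum_congr fun n => ?_
          have he := eS_pos hT n
          have : ∀ z, (if |z - s| ≤ 2 * eS T n then ENNReal.ofReal (eS T n ^ (-(α * p + 1))) else 0)
            * ‖X z - X s‖ₑ ^ p = (ENNReal.ofReal (eS T n ^ (-(α * p))) * ENNReal.ofReal (eS T n)⁻¹)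
              * ((if |z - s| ≤ 2 * eS T n then 1 else 0) * ‖X z - X s‖ₑ ^ p) := by
            intro z
            split_ifs
            · rw [one_mul, ← ENNReal.ofReal_mul (by positivity)]
              congr 2
              rw [neg_add, Real.rpow_add he, Real.rpow_neg_one]
            · simp
          simp only [this]
          rw [lintegral_const_mul' _ _ (ENNReal.mul_lt_top ENNReal.ofReal_lt_top
            ENNReal.ofReal_lt_top).ne]
          ring
      _ = C1 * C2 * C4 * ∫⁻ z in Icc 0 T, (∑' n,
          (if |z - s| ≤ 2 * eS T n then ENNReal.ofReal (eS T n ^ (-(α * p + 1))) else 0))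
            * ‖X z - X s‖ₑ ^ p := by
          rw [← lintegral_tsum]
          · simp only [ENNReal.tsum_mul_right]
          · intro n
            refine Measurable.aemeasurable (Measurable.mul ?_ (hmX.pow_const p))
            exact Measurable.ite (measurableSet_le (by fun_prop) (by fun_prop)) measurable_const
              measurable_const
      _ ≤ C1 * C2 * C4 * ∫⁻ z in Icc 0 T, C3 *
          ENNReal.ofReal (‖X s - X z‖ ^ p / |z - s| ^ (α * p + 1)) := by
          refine mul_le_mul_right (lintegral_mono fun z => ?_) _
          rcases eq_or_ne z s with rfl | hzs
          · simp [ENNReal.zero_rpow_of_pos hp0]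
          refine (mul_le_mul_left (h3 _ (abs_pos.2 (sub_ne_zero.2 hzs))) _).trans (le_of_eq ?_)
          rw [mul_assoc]
          congr 1
          rw [norm_sub_rev, div_eq_mul_inv, ENNReal.ofReal_mul (by positivity), mul_comm,
            ← ENNReal.ofReal_rpow_of_nonneg (norm_nonneg _) hp0.le, ofReal_norm]
      _ = _ := by
          rw [lintegral_const_mul' _ _ hC3.ne, ← mul_assoc]
  refine lt_of_le_of_lt (lintegral_mono key) ?_
  have hCC : C1 * C2 * C4 * C3 < ⊤ :=
    ENNReal.mul_lt_top (ENNReal.mul_lt_top (ENNReal.mul_lt_top hC1 hC2) hC4) hC3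
  rw [lintegral_const_mul' _ _ hCC.ne]
  exact ENNReal.mul_lt_top hCC hX

lemma lint_combine {F G H : ℝ → ℝ → ℝ≥0∞} {T : ℝ} (hFm : Measurable (Function.uncurry F))
    (hGm : Measurable (Function.uncurry G)) {K L : ℝ≥0∞} (hK : K < ⊤) (hL : L < ⊤)
    (hF : ∫⁻ s in Icc (0:ℝ) T, ∫⁻ t in Icc (0:ℝ) T, F s t < ⊤)
    (hG : ∫⁻ s in Icc (0:ℝ) T, ∫⁻ t in Icc (0:ℝ) T, G s t < ⊤)
    (hH : ∫⁻ s in Icc (0:ℝ) T, ∫⁻ t in Icc (0:ℝ) T, H s t < ⊤) :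
    ∫⁻ s in Icc (0:ℝ) T, ∫⁻ t in Icc (0:ℝ) T, (K * F s t + (L * G s t + L * H s t)) < ⊤ := by
  have hin : ∀ s, ∫⁻ t in Icc (0:ℝ) T, (K * F s t + (L * G s t + L * H s t))
      = K * (∫⁻ t in Icc (0:ℝ) T, F s t) + (L * (∫⁻ t in Icc (0:ℝ) T, G s t)
        + L * ∫⁻ t in Icc (0:ℝ) T, H s t) := by
    intro s
    have m1 : Measurable (F s) := hFm.of_uncurry_left
    have m2 : Measurable (G s) := hGm.of_uncurry_left
    rw [lintegral_add_left (m1.const_mul _), lintegral_add_left (m2.const_mul _),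
      lintegral_const_mul' _ _ hK.ne, lintegral_const_mul' _ _ hL.ne,
      lintegral_const_mul' _ _ hL.ne]
  simp only [hin]
  have n1 : Measurable fun s => ∫⁻ t in Icc (0:ℝ) T, F s t := hFm.lintegral_prod_right
  have n2 : Measurable fun s => ∫⁻ t in Icc (0:ℝ) T, G s t := hGm.lintegral_prod_right
  rw [lintegral_add_left (n1.const_mul _), lintegral_add_left (n2.const_mul _),
      lintegral_const_mul' _ _ hK.ne, lintegral_const_mul' _ _ hL.ne,
      lintegral_const_mul' _ _ hL.ne]
  exact ENNReal.add_lt_top.2 ⟨ENNReal.mul_lt_top hK hF, ENNReal.add_lt_top.2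
    ⟨ENNReal.mul_lt_top hL hG, ENNReal.mul_lt_top hL hH⟩⟩

lemma total_int {X : ℝ → V} (hXc : Continuous X) {α T p : ℝ} (hT : 0 < T) (hα : 0 < α)
    (hα2 : α < 1 / 2) (hp : 1 < p)
    (hX : ∫⁻ u in Icc (0:ℝ) T, ∫⁻ v in Icc (0:ℝ) T,
        ENNReal.ofReal (‖X u - X v‖ ^ p / |v - u| ^ (α * p + 1)) < ⊤) :
    ∫⁻ s in Icc (0:ℝ) T, ∫⁻ t in Icc (0:ℝ) T,
      (‖X t - X s‖ₑ + (Usum X T |t - s| s + Usum X T |t - s| t)) ^ p *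
        ENNReal.ofReal ((|t - s| ^ (α * p + 1))⁻¹) < ⊤ := by
  have hp0 : 0 < p := by linarith
  have hI := Usum_int hXc hT hα hα2 hp hX
  set ρ : ℝ → ℝ → ℝ≥0∞ := fun s t => ENNReal.ofReal ((|t - s| ^ (α * p + 1))⁻¹) with hρ
  have hρm' : Measurable (fun q : ℝ × ℝ => ρ q.1 q.2) := by
    simp only [hρ]; fun_prop
  have mU := measurable_Usum hXc T
  set F : ℝ → ℝ → ℝ≥0∞ := fun s t => ‖X t - X s‖ₑ ^ p * ρ s t with hF
  set G : ℝ → ℝ → ℝ≥0∞ := fun s t => Usum X T |t - s| s ^ p * ρ s t with hG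
  have hFm : Measurable (Function.uncurry F) := by
    have hc : Continuous fun q : ℝ × ℝ => ‖X q.2 - X q.1‖ₑ := by fun_prop
    have h2 := (hc.measurable.pow_const p).mul hρm'
    simp only [hF, Function.uncurry_def]
    exact h2
  have hGm : Measurable (Function.uncurry G) := by
    have h2 := (mU.pow_const p).mul hρm'
    simp only [hG, Function.uncurry_def]
    exact h2
  have hG2m : Measurable (Function.uncurry fun s t => G t s) := by
    have h2 := hGm.comp (measurable_swap (α := ℝ) (β := ℝ))
    exact h2
  have hFi : ∫⁻ s in Icc (0:ℝ) T, ∫⁻ t in Icc (0:ℝ) T, F s t < ⊤ := by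
    refine lt_of_le_of_lt (le_of_eq ?_) hX
    congr 1; ext s; congr 1; ext t
    simp only [hF, hρ]
    rw [norm_sub_rev, div_eq_mul_inv, ENNReal.ofReal_mul (by positivity),
            ← ENNReal.ofReal_rpow_of_nonneg (norm_nonneg _) hp0.le, ofReal_norm]
  have hG2i : ∫⁻ s in Icc (0:ℝ) T, ∫⁻ t in Icc (0:ℝ) T, G t s < ⊤ := by
    rw [lintegral_lintegral_swap hG2m.aemeasurable]
    exact hI
  set K : ℝ≥0∞ := 2 ^ (p - 1)
  have hK : K < ⊤ := ENNReal.rpow_lt_top_of_nonneg (by linarith) (by simp)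
  have hpt : ∀ s t, (‖X t - X s‖ₑ + (Usum X T |t - s| s + Usum X T |t - s| t)) ^ p * ρ s t
      ≤ K * F s t + (K * K * G s t + K * K * G t s) := by
    intro s t
    have a1 := ENNReal.rpow_add_le_mul_rpow_add_rpow ‖X t - X s‖ₑ
      (Usum X T |t - s| s + Usum X T |t - s| t) hp.le
    have a2 := ENNReal.rpow_add_le_mul_rpow_add_rpow (Usum X T |t - s| s) (Usum X T |t - s| t) hp.le
    have hs : ρ t s = ρ s t := by simp only [hρ, abs_sub_comm]
    have hs' : Usum X T |s - t| t = Usum X T |t - s| t := by rw [abs_sub_comm]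
    simp only [hF, hG, hs, hs']
    calc _ ≤ (K * (‖X t - X s‖ₑ ^ p + K * (Usum X T |t - s| s ^ p + Usum X T |t - s| t ^ p))) * ρ s t := by
          refine mul_le_mul_left (a1.trans ?_) _
          exact mul_le_mul_right (add_le_add le_rfl a2) _
      _ = _ := by ring
  refine lt_of_le_of_lt (lintegral_mono fun s => lintegral_mono fun t => hpt s t) ?_
  exact lint_combine hFm hGm hK (ENNReal.mul_lt_top hK hK) hFi hI hG2i

end


/-! ### Part F: assembling the lift -/

lemma ofReal_sqrt_le {x : ℝ} {Q : ℝ≥0∞} (h : ‖x‖ₑ ≤ 121 * Q ^ 2) :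
    ENNReal.ofReal (√|x|) ≤ 11 * Q := by
  rcases eq_or_ne Q ⊤ with rfl | hQ
  · simp [ENNReal.mul_top]
  · lift Q to NNReal using hQ
    have h1 : |x| ≤ 121 * (Q:ℝ) ^ 2 := by
      rw [Real.enorm_eq_ofReal_abs] at h
      have h2 := ENNReal.ofReal_le_iff_le_toReal (by finiteness) |>.1 h
      simpa using h2
    have h3 : √|x| ≤ 11 * (Q:ℝ) := by
      rw [Real.sqrt_le_left (by positivity)]
      nlinarith
    refine (ENNReal.ofReal_le_ofReal h3).trans (le_of_eq ?_)
    rw [ENNReal.ofReal_mul (by norm_num)]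
    simp

lemma enorm_mul_le_sq {x y : ℝ} {Q : ℝ≥0∞} (hx : ‖x‖ₑ ≤ Q) (hy : ‖y‖ₑ ≤ Q) : ‖x * y‖ₑ ≤ Q ^ 2 := by
  rw [enorm_mul, sq]; exact mul_le_mul' hx hy

lemma enorm_half_le {x : ℝ} {Q : ℝ≥0∞} (hx : ‖x‖ₑ ≤ Q) : ‖x / 2‖ₑ ≤ Q := by
  refine le_trans ?_ hx
  rw [Real.enorm_eq_ofReal_abs, Real.enorm_eq_ofReal_abs]
  apply ENNReal.ofReal_le_ofReal
  rw [abs_div, abs_of_pos (by norm_num : (0:ℝ) < 2)]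
  linarith [abs_nonneg x]

theorem lift_of_continuous
    (d : ℕ) (T α p : ℝ) (hT : 0 < T)
    (hα0 : 0 < α) (hα2 : α < 1 / 2) (hp : 1 < p) (hαp : 1 / p < α)
    (X : ℝ → EuclideanSpace ℝ (Fin d))
    (hXc : Continuous X)
    (hX : ∫⁻ u in Icc (0:ℝ) T, ∫⁻ v in Icc (0:ℝ) T,
        ENNReal.ofReal (‖X u - X v‖ ^ p / |v - u| ^ (α * p + 1)) < ⊤) :
    ∃ (b : ℝ → Matrix (Fin d) (Fin d) ℝ),
      ContinuousOn b (Icc 0 T) ∧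
      (∀ t, ∀ i j, b t i j + b t j i = X t i * X t j) ∧
      ∫⁻ s in Icc (0:ℝ) T, ∫⁻ t in Icc (0:ℝ) T,
          ENNReal.ofReal
            ((ccDist d (X s) (b s) (X t) (b t)) ^ p / |t - s| ^ (α * p + 1)) < ⊤ := by
  have hp0 : 0 < p := by linarith
  have hXi : ∀ i : Fin d, Continuous fun t => X t i := by
    intro i; fun_prop
  have hlip : ∀ i : Fin d, ∀ z w, |X z i - X w i| ≤ ‖X z - X w‖ := by
    intro i z w
    have := PiLp.norm_apply_le (X z - X w) i
    simpa using this
  choose h hhc hh using fun i j : Fin d =>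
    paraproduct hXc hT hp hα0 hαp hX (hXi i) (hlip i) (hXi j) (hlip j)
  set b : ℝ → Matrix (Fin d) (Fin d) ℝ := fun t => Matrix.of fun i j =>
    if i < j then h i j t else if j < i then X t i * X t j - h j i t else X t i * X t j / 2 with hb
  have hsym : ∀ t, ∀ i j, b t i j + b t j i = X t i * X t j := by
    intro t i j
    simp only [hb, Matrix.of_apply]
    rcases lt_trichotomy i j with hij | rfl | hij
    · simp only [hij, hij.not_gt, if_true, if_false]; ring
    · simp
    · simp only [hij, hij.not_gt, if_true, if_false]; ring
  refine ⟨b, ?_, hsym, ?_⟩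
  · refine continuousOn_pi.2 fun i => continuousOn_pi.2 fun j => ?_
    simp only [hb, Matrix.of_apply]
    rcases lt_trichotomy i j with hij | rfl | hij
    · simp only [hij, if_true]; exact hhc i j
    · simp only [lt_irrefl, if_false]
      exact (((hXi i).mul (hXi i)).div_const 2).continuousOn
    · simp only [hij, hij.not_gt, if_true, if_false]
      exact ((hXi i).mul (hXi j)).continuousOn.sub (hhc j i)
  · obtain ⟨C, hC0, hC⟩ := ccNorm_le d
    set Q : ℝ → ℝ → ℝ≥0∞ := fun s t =>
      ‖X t - X s‖ₑ + (Usum X T |t - s| s + Usum X T |t - s| t) with hQ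
    set K : ℝ≥0∞ := 1 + ENNReal.ofReal C * ∑ m : Fin d × Fin d, 11 with hKdef
    have hK : K < ⊤ := by
      refine ENNReal.add_lt_top.2 ⟨by simp, ENNReal.mul_lt_top ENNReal.ofReal_lt_top ?_⟩
      exact ENNReal.sum_lt_top.2 fun _ _ => by finiteness
    have hbound : ∀ s ∈ Icc 0 T, ∀ t ∈ Icc 0 T,
        ENNReal.ofReal (ccDist d (X s) (b s) (X t) (b t)) ≤ K * Q s t := by
      intro s hs t ht
      have hD : ∀ i, ‖X t i - X s i‖ₑ ≤ Q s t := by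
        intro i
        refine le_trans ?_ (le_self_add (b := Usum X T |t - s| s + Usum X T |t - s| t))
        rw [Real.enorm_eq_ofReal_abs, ← ofReal_norm]
        exact ENNReal.ofReal_le_ofReal (hlip i t s)
      have hrem : ∀ i j, ‖b t i j - b s i j - X s i * (X t j - X s j)
          - (X t i - X s i) * (X t j - X s j) / 2‖ₑ ≤ 121 * Q s t ^ 2 := by
        intro i j
        have hDD : ∀ i j, ‖(X t i - X s i) * (X t j - X s j)‖ₑ ≤ Q s t ^ 2 := fun i j =>
          enorm_mul_le_sq (hD i) (hD j)
        have hcomb : ∀ i j, ‖(h i j t - h i j s - X s i * (X t j - X s j))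
          - (X t i - X s i) * (X t j - X s j) / 2‖ₑ ≤ 121 * Q s t ^ 2 := by
          intro i j
          refine (enorm_sub_le).trans ?_
          refine (add_le_add (hh i j s hs t ht) (enorm_half_le (hDD i j))).trans ?_
          calc 100 * Q s t ^ 2 + Q s t ^ 2 ≤ 100 * Q s t ^ 2 + Q s t ^ 2 + 20 * Q s t ^ 2 := le_self_add
            _ = _ := by ring
        simp only [hb, Matrix.of_apply]
        rcases lt_trichotomy i j with hij | rfl | hij
        · simp only [hij, if_true]
          exact hcomb i j
        · simp only [lt_irrefl, if_false]
          have : X t i * X t i / 2 - X s i * X s i / 2 - X s i * (X t i - X s i)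
            - (X t i - X s i) * (X t i - X s i) / 2 = 0 := by ring
          rw [this]; simp
        · simp only [hij, hij.not_gt, if_true, if_false]
          rw [← enorm_neg]
          refine le_trans (le_of_eq ?_) (hcomb j i)
          congr 1; ring
      have hcc := hC (X t - X s) (Matrix.of fun i j => b t i j - b s i j - X s i * (X t j - X s j)) (by
        intro i j
        have h1 := hsym t i j
        have h2 := hsym s i j
        simp only [Matrix.of_apply, PiLp.sub_apply]
        linear_combination h1 - h2)
      unfold ccDist
      refine (ENNReal.ofReal_le_ofReal hcc).trans ?_
      rw [ENNReal.ofReal_add (norm_nonneg _) (mul_nonneg hC0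
        (Finset.sum_nonneg fun _ _ => Real.sqrt_nonneg _)), ENNReal.ofReal_mul hC0,
        ENNReal.ofReal_sum_of_nonneg (fun _ _ => Real.sqrt_nonneg _), hKdef, add_mul, one_mul,
        mul_assoc, Finset.sum_mul, ofReal_norm]
      refine add_le_add le_self_add (mul_le_mul_right (Finset.sum_le_sum fun m _ => ?_) _)
      apply ofReal_sqrt_le
      have := hrem m.1 m.2
      simpa only [Matrix.of_apply, PiLp.sub_apply] using this
    have hfin := total_int hXc hT hα0 hα2 hp hX
    have hKp : K ^ p < ⊤ := ENNReal.rpow_lt_top_of_nonneg hp0.le hK.ne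
    refine lt_of_le_of_lt (b := ∫⁻ s in Icc (0:ℝ) T, ∫⁻ t in Icc (0:ℝ) T,
      K ^ p * (Q s t ^ p * ENNReal.ofReal ((|t - s| ^ (α * p + 1))⁻¹))) ?_ ?_
    · refine setLIntegral_mono' measurableSet_Icc fun s hs => ?_
      refine setLIntegral_mono' measurableSet_Icc fun t ht => ?_
      have hn : 0 ≤ ccDist d (X s) (b s) (X t) (b t) := ccNorm_nonneg _ _ _
      rw [div_eq_mul_inv, ENNReal.ofReal_mul (by positivity),
        ← ENNReal.ofReal_rpow_of_nonneg hn hp0.le, ← mul_assoc,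
        ← ENNReal.mul_rpow_of_nonneg _ _ hp0.le]
      exact mul_le_mul_left (ENNReal.rpow_le_rpow (hbound s hs t ht) hp0.le) _
    · simp only [lintegral_const_mul' _ _ hKp.ne]
      exact ENNReal.mul_lt_top hKp hfin


/-- Lyons–Victoir extension in the Sobolev scale (Theorem 3.5): every
`X ∈ W^α_p([0,T]; ℝ^d)` with `1/3 < α < 1/2`, `α > 1/p`, can be lifted to a weakly
geometric Sobolev rough path `𝐗 ∈ W^α_p([0,T]; G²(ℝ^d))` with
`π₁(𝐗_{0,t}) = X_t - X_0`.  The `G²(ℝ^d)`-valued path `𝐗_t = (1, a(t), b(t))` is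
encoded by its two levels: `a` (first level), `b` (second level), subject to the
weak-geometricity constraint `Sym(b) = ½ a ⊗ a`. -/
theorem sobolev_rough_path_lift
    (d : ℕ) (hd : 0 < d) (T α p : ℝ) (hT : 0 < T)
    (hα : α ∈ Set.Ioo (1/3 : ℝ) (1/2)) (hp : 1 < p) (hαp : 1 / p < α)
    (X : ℝ → EuclideanSpace ℝ (Fin d))
    (hXc : ContinuousOn X (Icc 0 T))
    (hX : ∫⁻ u in Icc (0:ℝ) T, ∫⁻ v in Icc (0:ℝ) T,
        ENNReal.ofReal (‖X u - X v‖ ^ p / |v - u| ^ (α * p + 1)) < ⊤) :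
    ∃ (a : ℝ → EuclideanSpace ℝ (Fin d)) (b : ℝ → Matrix (Fin d) (Fin d) ℝ),
      ContinuousOn a (Icc 0 T) ∧ ContinuousOn b (Icc 0 T) ∧
      (∀ t ∈ Icc (0:ℝ) T, ∀ i j, b t i j + b t j i = a t i * a t j) ∧
      (∀ t ∈ Icc (0:ℝ) T, a t - a 0 = X t - X 0) ∧
      ∫⁻ s in Icc (0:ℝ) T, ∫⁻ t in Icc (0:ℝ) T,
          ENNReal.ofReal
            ((ccDist d (a s) (b s) (a t) (b t)) ^ p / |t - s| ^ (α * p + 1)) < ⊤ := by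
  obtain ⟨hα1, hα2⟩ := hα
  have hα0 : 0 < α := by linarith
  set Y : ℝ → EuclideanSpace ℝ (Fin d) := fun t => X (projIcc 0 T hT.le t) with hY
  have hYX : ∀ t ∈ Icc 0 T, Y t = X t := by
    intro t ht
    simp only [hY, projIcc_of_mem hT.le ht]
  have hYc : Continuous Y := by
    have h1 : Continuous ((Icc 0 T).restrict X) := continuousOn_iff_continuous_restrict.1 hXc
    exact h1.comp continuous_projIcc
  have hYi : ∫⁻ u in Icc (0:ℝ) T, ∫⁻ v in Icc (0:ℝ) T,
        ENNReal.ofReal (‖Y u - Y v‖ ^ p / |v - u| ^ (α * p + 1)) < ⊤ := by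
    refine lt_of_le_of_lt (le_of_eq ?_) hX
    refine setLIntegral_congr_fun measurableSet_Icc fun u hu => ?_
    refine setLIntegral_congr_fun measurableSet_Icc fun v hv => ?_
    simp only [hYX u hu, hYX v hv]
  obtain ⟨b, hbc, hsym, hfin⟩ := lift_of_continuous d T α p hT hα0 hα2 hp hαp Y hYc hYi
  refine ⟨Y, b, hYc.continuousOn, hbc, fun t _ => hsym t, ?_, hfin⟩
  intro t ht
  rw [hYX t ht, hYX 0 ⟨le_rfl, hT.le⟩]
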